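/- arXiv:1305.3960 — 2 statements merged into one kernel-verified Lean document; each statement's English description precedes it below -/
import Mathlib

section
/- Let M be a loopless oriented matroid and N a matroid with rank function ρ, both on the same finite ground set V, with rank(M) < rank(N). If every subset A ⊆ V with ρ(V − A) < rank(M) contains a positive circuit of M, then there exists a positive circuit of M that is an independent set of N. -/
/-- An abstract simplicial complex on vertex type `V` (containing the empty face). -/
structure SimplicialCpx (V : Type*) where
  faces : Set (Finset V)
  down_closed : ∀ s ∈ faces, ∀ t ⊆ s, t ∈ faces
  empty_mem : (∅ : Finset V) ∈ faces

namespace SimplicialCpx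

variable {V : Type*}

/-- `n`-dimensional chains: formal ℚ-linear combinations of faces of cardinality `n`
(the degree is shifted by one from the usual convention: cardinality `n` faces
have topological dimension `n - 1`; cardinality `0` chains are spanned by the
empty face, giving *reduced* homology). -/
abbrev Chain (X : SimplicialCpx V) (n : ℕ) : Type _ :=
  {s : Finset V // s ∈ X.faces ∧ s.card = n} →₀ ℚ

variable [LinearOrder V]

/-- The simplicial boundary map, from chains on cardinality `n+1` faces to chains on
cardinality `n` faces, with signs determined by the linear order on the vertices. -/
noncomputable def bdry (X : SimplicialCpx V) (n : ℕ) :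
    X.Chain (n + 1) →ₗ[ℚ] X.Chain n :=
  Finsupp.lsum ℚ fun s => LinearMap.toSpanSingleton ℚ (X.Chain n)
    (∑ v ∈ s.1.attach, ((-1 : ℚ) ^ (s.1.filter (· < v.1)).card) •
      Finsupp.single ⟨s.1.erase v.1,
        ⟨X.down_closed _ s.2.1 _ (Finset.erase_subset _ _), by
          rw [Finset.card_erase_of_mem v.2, s.2.2]; rfl⟩⟩ (1 : ℚ))

/-- The cycles of cardinality `n`: all chains for `n = 0`, kernel of the boundary otherwise. -/
noncomputable def cycles (X : SimplicialCpx V) : (n : ℕ) → Submodule ℚ (X.Chain n)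
  | 0 => ⊤
  | (m + 1) => LinearMap.ker (X.bdry m)

/-- Reduced simplicial homology with rational coefficients, indexed so that
`X.redH n` is the reduced homology group `H̃_{n-1}(X; ℚ)` in the usual topological
indexing (thus `X.redH 0 = H̃_{-1}`). -/
noncomputable def redH (X : SimplicialCpx V) (n : ℕ) : Type _ :=
  (X.cycles n) ⧸ (Submodule.comap (X.cycles n).subtype (LinearMap.range (X.bdry n)))

noncomputable instance (X : SimplicialCpx V) (n : ℕ) : AddCommGroup (X.redH n) :=
  inferInstanceAs (AddCommGroup ((X.cycles n) ⧸ _))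

noncomputable instance (X : SimplicialCpx V) (n : ℕ) : Module ℚ (X.redH n) :=
  inferInstanceAs (Module ℚ ((X.cycles n) ⧸ _))

/-- `η(X) = min { j : H̃_j(X;ℚ) ≠ 0 } + 1`, which in our shifted indexing is
`min { n : X.redH n ≠ 0 }`; it is `⊤` if all reduced homology vanishes. -/
noncomputable def eta (X : SimplicialCpx V) : ℕ∞ :=
  sInf {n : ℕ∞ | ∃ m : ℕ, n = (m : ℕ∞) ∧ Nontrivial (X.redH m)}

/-- The induced subcomplex on a vertex subset `S`. -/
def induce (X : SimplicialCpx V) (S : Set V) : SimplicialCpx V where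
  faces := {t | t ∈ X.faces ∧ ↑t ⊆ S}
  down_closed := fun s hs t hts =>
    ⟨X.down_closed s hs.1 t hts, subset_trans (by exact_mod_cast hts) hs.2⟩
  empty_mem := ⟨X.empty_mem, by simp⟩

/-- The link of a face `T` in `X`. -/
def link (X : SimplicialCpx V) (T : Finset V) (hT : T ∈ X.faces) : SimplicialCpx V where
  faces := {R | Disjoint R T ∧ R ∪ T ∈ X.faces}
  down_closed := fun s hs t hts =>
    ⟨Finset.disjoint_of_subset_left hts hs.1,
     X.down_closed _ hs.2 _ (Finset.union_subset_union_left hts)⟩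
  empty_mem := ⟨Finset.disjoint_empty_left T, by simpa using hT⟩

/-- The Alexander dual `X^⋆ = { T ⊆ V : V - T ∉ X }` (a simplicial complex provided
the full vertex set is not a face of `X`). -/
def dual [Fintype V] [DecidableEq V] (X : SimplicialCpx V)
    (h : (Finset.univ : Finset V) ∉ X.faces) : SimplicialCpx V where
  faces := {T | Finset.univ \ T ∉ X.faces}
  down_closed := fun s hs t hts hmem =>
    hs (X.down_closed _ hmem _ (Finset.sdiff_subset_sdiff (subset_refl _) hts))
  empty_mem := by simpa using h

end SimplicialCpx
/-- A signed subset of `V`: a pair of disjoint finite sets of positive and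
negative elements. -/
structure SignedSet (V : Type*) [DecidableEq V] where
  pos : Finset V
  neg : Finset V
  disj : Disjoint pos neg

namespace SignedSet

variable {V : Type*} [DecidableEq V]

/-- The support of a signed set. -/
def support (C : SignedSet V) : Finset V := C.pos ∪ C.neg

/-- The negation of a signed set. -/
def negate (C : SignedSet V) : SignedSet V := ⟨C.neg, C.pos, C.disj.symm⟩

end SignedSet

/-- An oriented matroid on `V`, given by its signed circuit axioms. -/
structure OrientedMatroid (V : Type*) [DecidableEq V] where
  Circuits : Set (SignedSet V)
  support_nonempty : ∀ C ∈ Circuits, C.support.Nonempty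
  negate_mem : ∀ C ∈ Circuits, C.negate ∈ Circuits
  incomparable : ∀ C ∈ Circuits, ∀ D ∈ Circuits,
    C.support ⊆ D.support → C = D ∨ C = D.negate
  elimination : ∀ C ∈ Circuits, ∀ D ∈ Circuits, C ≠ D.negate →
    ∀ e ∈ C.pos ∩ D.neg, ∃ Z ∈ Circuits,
      Z.pos ⊆ (C.pos ∪ D.pos).erase e ∧ Z.neg ⊆ (C.neg ∪ D.neg).erase e

namespace OrientedMatroid

variable {V : Type*} [DecidableEq V]

/-- A set is independent in (the underlying matroid of) an oriented matroid if it
contains no circuit support. -/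
def Indep (M : OrientedMatroid V) (S : Finset V) : Prop :=
  ∀ C ∈ M.Circuits, ¬ C.support ⊆ S

/-- The rank of (the underlying matroid of) an oriented matroid: the maximal
cardinality of an independent set. -/
noncomputable def rank [Fintype V] (M : OrientedMatroid V) : ℕ :=
  sSup {n | ∃ S : Finset V, M.Indep S ∧ S.card = n}

/-- An oriented matroid is loopless if it has no one-element circuits. -/
def Loopless (M : OrientedMatroid V) : Prop :=
  ∀ C ∈ M.Circuits, C.support.card ≠ 1

/-- `S` is a positive circuit of `M`: the set of positive elements of a circuit
with no negative elements. -/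
def PosCircuit (M : OrientedMatroid V) (S : Finset V) : Prop :=
  ∃ C ∈ M.Circuits, C.neg = ∅ ∧ C.pos = S

/-- The support complex of an oriented matroid: faces are the sets containing no
positive circuit. -/
def suppComplex (M : OrientedMatroid V) : SimplicialCpx V where
  faces := {S | ∀ T ⊆ S, ¬ M.PosCircuit T}
  down_closed := fun s hs t hts T hTt => hs T (hTt.trans hts)
  empty_mem := by
    intro T hT hPC
    obtain ⟨C, hC, hneg, hpos⟩ := hPC
    obtain ⟨x, hx⟩ := M.support_nonempty C hC
    rw [SignedSet.support, hneg, hpos] at hx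
    have : T = ∅ := Finset.subset_empty.mp hT
    subst this
    simp at hx

end OrientedMatroid
/-- A matroid on a finite ground set, given by its independent sets. -/
structure FinMatroid (V : Type*) [DecidableEq V] where
  Indep : Finset V → Prop
  empty_indep : Indep ∅
  indep_subset : ∀ ⦃s t : Finset V⦄, Indep s → t ⊆ s → Indep t
  indep_exchange : ∀ ⦃s t : Finset V⦄, Indep s → Indep t → s.card < t.card →
    ∃ x ∈ t, x ∉ s ∧ Indep (insert x s)

namespace FinMatroid

variable {V : Type*} [DecidableEq V]

/-- The rank function of a matroid: the maximal cardinality of an independent subset. -/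
noncomputable def rk (N : FinMatroid V) (S : Finset V) : ℕ :=
  sSup {n | ∃ I : Finset V, I ⊆ S ∧ N.Indep I ∧ I.card = n}

/-- The rank of a matroid on a finite ground set. -/
noncomputable def rank [Fintype V] (N : FinMatroid V) : ℕ := N.rk Finset.univ

/-- The independence complex of a matroid. -/
def indepComplex (N : FinMatroid V) : SimplicialCpx V where
  faces := {s | N.Indep s}
  down_closed := fun _ hs _ hts => N.indep_subset hs hts
  empty_mem := N.empty_indep

/-- The restriction of a matroid to a subset `S` of the ground set: independent sets
are the independent sets of `N` contained in `S`. -/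
def restrict (N : FinMatroid V) (S : Finset V) : FinMatroid V where
  Indep := fun t => N.Indep t ∧ t ⊆ S
  empty_indep := ⟨N.empty_indep, Finset.empty_subset S⟩
  indep_subset := fun _ _ hs hts => ⟨N.indep_subset hs.1 hts, hts.trans hs.2⟩
  indep_exchange := fun s t hs ht hcard => by
    obtain ⟨x, hxt, hxs, hx⟩ := N.indep_exchange hs.1 ht.1 hcard
    exact ⟨x, hxt, hxs, hx, Finset.insert_subset (ht.2 hxt) hs.2⟩

/-- A basis of a matroid on a finite ground set: a maximal independent set. -/
def IsBasis [Fintype V] (N : FinMatroid V) (B : Finset V) : Prop :=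
  N.Indep B ∧ ∀ B', N.Indep B' → B ⊆ B' → B = B'

end FinMatroid


/-- The signed circuit axioms, for circuits encoded as sign vectors. -/
structure IsSignedCircuits {V : Type*} (K : Set (V → SignType)) : Prop where
  neg_mem : ∀ C ∈ K, -C ∈ K
  eq_or_eq_neg : ∀ C ∈ K, ∀ D ∈ K, (∀ k, C k ≠ 0 → D k ≠ 0) → C = D ∨ C = -D
  elim : ∀ C ∈ K, ∀ D ∈ K, C ≠ -D → ∀ e, C e ≠ 0 → D e = -C e →
    ∃ Z ∈ K, Z e = 0 ∧ ∀ k, Z k ≠ 0 → Z k = C k ∨ Z k = D k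

namespace IsSignedCircuits

variable {V : Type*} {K : Set (V → SignType)}

theorem exists_notMem_support (hK : IsSignedCircuits K) {X Z : V → SignType} (hX : X ∈ K)
    (hZ : Z ∈ K) {e : V} (hXe : X e ≠ 0) (hZe : Z e = 0) : ∃ g, Z g ≠ 0 ∧ X g = 0 := by
  by_contra! h
  rcases hK.eq_or_eq_neg Z hZ X hX h with rfl | rfl
  · exact hXe hZe
  · simp at hZe; exact hXe hZe

/-- Strong elimination, in the case where the retained element lies in only one circuit. -/
theorem strong_elim [Fintype V] (hK : IsSignedCircuits K) {X Y : V → SignType}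
    (hX : X ∈ K) (hY : Y ∈ K) {e f : V} (hXe : X e ≠ 0) (hYe : Y e = -X e) (hXf : X f ≠ 0)
    (hYf : Y f = 0) :
    ∃ Z ∈ K, Z e = 0 ∧ Z f ≠ 0 ∧ ∀ k, Z k ≠ 0 → Z k = X k ∨ Z k = Y k := by
  classical
  suffices H : ∀ n m : ℕ, ∀ X ∈ K, ∀ Y ∈ K, ∀ e f : V,
      (Finset.univ.filter fun k => X k ≠ 0 ∨ Y k ≠ 0).card = n →
      (Finset.univ.filter fun k => X k ≠ 0 ∧ Y k = -X k).card = m →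
      X e ≠ 0 → Y e = -X e → X f ≠ 0 → Y f = 0 →
      ∃ Z ∈ K, Z e = 0 ∧ Z f ≠ 0 ∧ ∀ k, Z k ≠ 0 → Z k = X k ∨ Z k = Y k from
    H _ _ X hX Y hY e f rfl rfl hXe hYe hXf hYf
  clear! X Y e f
  intro n
  induction n using Nat.strong_induction_on with | _ n ihn
  intro m
  induction m using Nat.strong_induction_on with | _ m ihm
  intro X hX Y hY e f hn hm hXe hYe hXf hYf
  have ih_union : ∀ X' ∈ K, ∀ Y' ∈ K, ∀ e' f' g : V, (X g ≠ 0 ∨ Y g ≠ 0) →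
      X' g = 0 → Y' g = 0 → (∀ k, X' k ≠ 0 ∨ Y' k ≠ 0 → X k ≠ 0 ∨ Y k ≠ 0) →
      X' e' ≠ 0 → Y' e' = -X' e' → X' f' ≠ 0 → Y' f' = 0 →
      ∃ Z ∈ K, Z e' = 0 ∧ Z f' ≠ 0 ∧ ∀ k, Z k ≠ 0 → Z k = X' k ∨ Z k = Y' k := by
    intro X' hX' Y' hY' e' f' g hg hXg hYg hsub
    refine ihn _ ?_ _ X' hX' Y' hY' e' f' rfl rfl
    rw [← hn]
    refine Finset.card_lt_card (Finset.ssubset_iff_subset_ne.2 ⟨?_, ?_⟩)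
    · intro k; simpa using hsub k
    · intro h
      have := Finset.ext_iff.1 h g
      simp only [Finset.mem_filter, Finset.mem_univ, true_and] at this
      tauto
  have ih_conflict : ∀ X' ∈ K, ∀ Y' ∈ K, ∀ e' f' g : V, X g ≠ 0 → Y g = -X g →
      (X' g = 0 ∨ Y' g = 0) → (∀ k, X' k ≠ 0 ∨ Y' k ≠ 0 → X k ≠ 0 ∨ Y k ≠ 0) →
      (∀ k, X' k ≠ 0 → Y' k = -X' k → X k ≠ 0 ∧ Y k = -X k) →
      X' e' ≠ 0 → Y' e' = -X' e' → X' f' ≠ 0 → Y' f' = 0 →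
      ∃ Z ∈ K, Z e' = 0 ∧ Z f' ≠ 0 ∧ ∀ k, Z k ≠ 0 → Z k = X' k ∨ Z k = Y' k := by
    intro X' hX' Y' hY' e' f' g hXg hYg hg hsub hsub'
    have hD : (Finset.univ.filter fun k => X' k ≠ 0 ∧ Y' k = -X' k).card < m := by
      rw [← hm]
      refine Finset.card_lt_card (Finset.ssubset_iff_subset_ne.2 ⟨?_, ?_⟩)
      · intro k; simpa using hsub' k
      · intro h
        have := Finset.ext_iff.1 h g
        simp only [Finset.mem_filter, Finset.mem_univ, true_and] at this
        have h' := this.2 ⟨hXg, hYg⟩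
        rcases hg with hg | hg
        · exact h'.1 hg
        · exact h'.1 (by simpa [hg] using h'.2.symm)
    have hE : (Finset.univ.filter fun k => X' k ≠ 0 ∨ Y' k ≠ 0).card ≤ n := by
      rw [← hn]
      exact Finset.card_le_card fun k => by simpa using hsub k
    rcases hE.lt_or_eq with hE | hE
    · exact ihn _ hE _ X' hX' Y' hY' e' f' rfl rfl
    · exact ihm _ hD X' hX' Y' hY' e' f' hE rfl
  obtain ⟨Z, hZ, hZe, hZc⟩ := hK.elim X hX Y hY
    (fun h => hXf (by simp [h, hYf])) e hXe hYe
  by_cases hZf : Z f ≠ 0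
  · exact ⟨Z, hZ, hZe, hZf, hZc⟩
  rw [not_not] at hZf
  by_cases hA : ∃ h, X h ≠ 0 ∧ Z h = -X h
  · obtain ⟨h, hXh, hZh⟩ := hA
    have hYh : Y h = -X h := by
      have := hZc h
      revert hXh hZh this
      generalize X h = a, Y h = b, Z h = c
      decide +revert
    obtain ⟨X', hX', hX'h, hX'f, hX'c⟩ := ih_conflict X hX Z hZ h f e hXe hYe (Or.inr hZe)
      (fun k => by
        have := hZc k
        revert this; generalize X k = a, Y k = b, Z k = c; decide +revert)
      (fun k => by
        have := hZc k
        revert this; generalize X k = a, Y k = b, Z k = c; decide +revert) hXh hZh hXf hZf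
    by_cases hX'e : X' e = 0
    · refine ⟨X', hX', hX'e, hX'f, fun k => ?_⟩
      have := hZc k
      have := hX'c k
      revert this; revert this
      generalize X k = a, Y k = b, Z k = c, X' k = d; decide +revert
    obtain ⟨W, hW, hWe, hWf, hWc⟩ := ih_conflict X' hX' Y hY e f h hXh hYh (Or.inl hX'h)
      (fun k => by
        have h1 := hZc k
        have h2 := hX'c k
        revert h1 h2; generalize X k = a, Y k = b, Z k = c, X' k = d; decide +revert)
      (fun k => by
        have h1 := hZc k
        have h2 := hX'c k
        revert h1 h2; generalize X k = a, Y k = b, Z k = c, X' k = d; decide +revert)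
      hX'e (by
        have h2 := hX'c e
        revert hX'e hZe hYe hXe h2
        generalize X e = a, Y e = b, Z e = c, X' e = d; decide +revert) hX'f hYf
    refine ⟨W, hW, hWe, hWf, fun k => ?_⟩
    have h1 := hZc k
    have h2 := hX'c k
    have h3 := hWc k
    revert h1 h2 h3
    generalize X k = a, Y k = b, Z k = c, X' k = d, W k = w; decide +revert
  push Not at hA
  obtain ⟨g, hZg, hXg⟩ := hK.exists_notMem_support hX hZ hXe hZe
  have hYg : Y g = Z g := by
    have := hZc g
    revert hZg hXg this; generalize X g = a, Y g = b, Z g = c; decide +revert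
  have hYe0 : Y e ≠ 0 := by simpa [hYe] using hXe
  obtain ⟨Y', hY', hY'g, hY'e, hY'c⟩ := ih_union Y hY (-Z) (hK.neg_mem Z hZ) g e f (Or.inl hXf)
    hYf (by simpa using hZf)
    (fun k => by
      have := hZc k
      simp only [Pi.neg_apply]
      revert this; generalize X k = a, Y k = b, Z k = c; decide +revert)
    (by rwa [hYg]) (by simp [hYg]) hYe0 (by simpa using hZe)
  simp only [Pi.neg_apply] at hY'c
  obtain ⟨Z₁, hZ₁, hZ₁e, hZ₁f, hZ₁c⟩ := ih_union X hX Y' hY' e f g (Or.inr (hYg ▸ hZg)) hXg hY'g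
    (fun k => by
      have h1 := hZc k
      have h2 := hY'c k
      revert h1 h2; generalize X k = a, Y k = b, Z k = c, Y' k = d; decide +revert)
    hXe (by
      have h2 := hY'c e
      revert h2 hYe hZe hXe hY'e
      generalize X e = a, Y e = b, Z e = c, Y' e = d; decide +revert) hXf
    (by
      have h2 := hY'c f
      revert h2 hYf hZf
      generalize Y f = b, Z f = c, Y' f = d; decide +revert)
  have key : ∀ l : ℕ, ∀ Z₁ ∈ K, (Finset.univ.filter fun k => Z₁ k ≠ 0 ∧ Z k = -Z₁ k).card = l →
      Z₁ e = 0 → Z₁ f ≠ 0 → (∀ k, Z₁ k ≠ 0 → Z₁ k = X k ∨ Z₁ k = Y k ∨ Z₁ k = -Z k) →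
      ∃ W ∈ K, W e = 0 ∧ W f ≠ 0 ∧ ∀ k, W k ≠ 0 → W k = X k ∨ W k = Y k := by
    intro l
    induction l using Nat.strong_induction_on with | _ l ihl
    intro Z₁ hZ₁ hl hZ₁e hZ₁f hZ₁c
    by_cases hbad : ∃ k, Z₁ k ≠ 0 ∧ Z k = -Z₁ k
    · obtain ⟨k, hk, hkZ⟩ := hbad
      obtain ⟨Z₂, hZ₂, hZ₂k, hZ₂f, hZ₂c⟩ := ih_union Z₁ hZ₁ Z hZ k f e (Or.inl hXe) hZ₁e hZe
        (fun k => by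
          have h1 := hZc k
          have h2 := hZ₁c k
          revert h1 h2; generalize X k = a, Y k = b, Z k = c, Z₁ k = d; decide +revert)
        hk hkZ hZ₁f hZf
      refine ihl _ ?_ Z₂ hZ₂ rfl ?_ hZ₂f ?_
      · rw [← hl]
        refine Finset.card_lt_card (Finset.ssubset_iff_subset_ne.2 ⟨?_, ?_⟩)
        · intro j
          simp only [Finset.mem_filter, Finset.mem_univ, true_and]
          have h2 := hZ₂c j
          revert h2; generalize Z j = c, Z₁ j = d, Z₂ j = a; decide +revert
        · intro h
          have := Finset.ext_iff.1 h k
          simp only [Finset.mem_filter, Finset.mem_univ, true_and] at this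
          exact (this.2 ⟨hk, hkZ⟩).1 hZ₂k
      · have h2 := hZ₂c e
        revert h2 hZ₁e hZe; generalize Z e = c, Z₁ e = d, Z₂ e = a; decide +revert
      · intro j
        have h1 := hZc j
        have h2 := hZ₂c j
        have h3 := hZ₁c j
        revert h1 h2 h3
        generalize X j = a, Y j = b, Z j = c, Z₁ j = d, Z₂ j = w; decide +revert
    · push Not at hbad
      refine ⟨Z₁, hZ₁, hZ₁e, hZ₁f, fun k => ?_⟩
      have h1 := hbad k
      have h2 := hZ₁c k
      revert h1 h2; generalize X k = a, Y k = b, Z k = c, Z₁ k = d; decide +revert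
  refine key _ Z₁ hZ₁ rfl hZ₁e hZ₁f fun k => ?_
  have h1 := hY'c k
  have h2 := hZ₁c k
  revert h1 h2; generalize X k = a, Y k = b, Z k = c, Z₁ k = d, Y' k = w; decide +revert

end IsSignedCircuits

/-- The sign vectors orthogonal to every circuit supported in `S`. -/
def covectors {V : Type*} (K : Set (V → SignType)) (S : Set V) : Set (V → SignType) :=
  {Y | ∀ C ∈ K, (∀ k, C k ≠ 0 → k ∈ S) → ∀ k, Y k * C k = 1 → ∃ j, Y j * C j = -1}

/-- The composition of two sign vectors. -/
def signComp {V : Type*} (Y Z : V → SignType) : V → SignType :=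
  fun k => if Y k = 0 then Z k else Y k

theorem signComp_mem {V : Type*} {K : Set (V → SignType)} {S : Set V}
    {Y Z : V → SignType} (hY : Y ∈ covectors K S)
    (hZ : Z ∈ covectors K S) : signComp Y Z ∈ covectors K S := by
  intro C hC hCS k hk
  by_cases h : ∃ j, Y j * C j ≠ 0
  · obtain ⟨j, hj⟩ := h
    have hneg : ∃ i, Y i * C i = -1 := by
      rcases SignType.trichotomy (Y j * C j) with h | h | h
      · exact ⟨j, h⟩
      · exact absurd h hj
      · exact hY C hC hCS j h
    obtain ⟨i, hi⟩ := hneg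
    refine ⟨i, ?_⟩
    have : Y i ≠ 0 := by rintro h; simp [h] at hi
    simp [signComp, this, hi]
  · push Not at h
    have key : ∀ i, signComp Y Z i * C i = Z i * C i := by
      intro i
      have := h i
      unfold signComp
      revert this
      generalize Y i = a, Z i = b, C i = c
      decide +revert
    simp only [key] at hk ⊢
    exact hZ C hC hCS k hk

namespace IsSignedCircuits

variable {V : Type*} {K : Set (V → SignType)}

/-- Two circuits of opposite signs at `v`, both weakly conformal with a covector `Y` elsewhere,
cannot exist unless both are orthogonal to `Y` in the trivial way. -/
theorem no_conflict [Fintype V] (hK : IsSignedCircuits K) {S : Set V} {Y : V → SignType}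
    (hY : Y ∈ covectors K S) {v : V} {X : V → SignType} (hX : X ∈ K)
    (hXS : ∀ k, X k ≠ 0 → k = v ∨ k ∈ S) (hXv : X v ≠ 0)
    (hXY : ∀ k, k ≠ v → Y k * X k ≠ -1) {f : V} (hfv : f ≠ v) (hXf : Y f * X f = 1)
    {Z : V → SignType} (hZ : Z ∈ K) (hZS : ∀ k, Z k ≠ 0 → k = v ∨ k ∈ S) (hZv : Z v = -X v)
    (hZY : ∀ k, k ≠ v → Y k * Z k ≠ -1) : False := by
  classical
  induction hn : (Finset.univ.filter fun k => X k ≠ 0 ∨ Z k ≠ 0).card using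
    Nat.strong_induction_on generalizing Z with | _ n ih
  have hXf0 : X f ≠ 0 := by rintro h; simp [h] at hXf
  by_cases hZf : Z f = 0
  · obtain ⟨W, hW, hWv, hWf, hWc⟩ := hK.strong_elim hX hZ hXv hZv hXf0 hZf
    have hWf' : Y f * W f = 1 := by
      have := hWc f
      revert this hZf hWf hXf
      generalize Y f = a, W f = b, X f = c, Z f = d; decide +revert
    obtain ⟨j, hj⟩ := hY W hW (fun k hk => by
      have h0 : k ≠ v := by rintro rfl; exact hk hWv
      rcases hWc k hk with h | h
      · exact (hXS k (h ▸ hk)).resolve_left h0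
      · exact (hZS k (h ▸ hk)).resolve_left h0) f hWf'
    have hjv : j ≠ v := by rintro rfl; simp [hWv] at hj
    have h1 := hXY j hjv
    have h2 := hZY j hjv
    have h3 := hWc j
    revert h1 h2 h3 hj
    generalize Y j = a, W j = b, X j = c, Z j = d; decide +revert
  · have hZf' : Z f = X f := by
      have := hZY f hfv
      revert this hXf hZf
      generalize Y f = a, X f = c, Z f = d; decide +revert
    obtain ⟨W, hW, hWv, hWc⟩ := hK.elim X hX Z hZ (fun h => by
      have := congrFun h f
      rw [Pi.neg_apply, hZf'] at this
      revert this hXf0; generalize X f = a; decide +revert) v hXv hZv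
    have hWS : ∀ k, W k ≠ 0 → k ∈ S := fun k hk => by
      have h0 : k ≠ v := by rintro rfl; exact hk hWv
      rcases hWc k hk with h | h
      · exact (hXS k (h ▸ hk)).resolve_left h0
      · exact (hZS k (h ▸ hk)).resolve_left h0
    have hWY' : ∀ k, Y k * W k ≠ -1 := fun k hk => by
      have hkv : k ≠ v := by rintro rfl; simp [hWv] at hk
      have h1 := hXY k hkv
      have h2 := hZY k hkv
      have h3 := hWc k
      revert h1 h2 h3 hk
      generalize Y k = a, W k = b, X k = c, Z k = d; decide +revert
    have hWY : ∀ k, Y k * W k = 0 := fun k => by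
      rcases SignType.trichotomy (Y k * W k) with h | h | h
      · exact absurd h (hWY' k)
      · exact h
      · obtain ⟨j, hj⟩ := hY W hW hWS k h
        exact absurd hj (hWY' j)
    obtain ⟨g, hWg, hXg⟩ := hK.exists_notMem_support hX hW hXv hWv
    have hZg : Z g = W g := by
      have := hWc g
      revert hWg hXg this; generalize X g = a, Z g = b, W g = c; decide +revert
    have hZv0 : Z v ≠ 0 := by simpa [hZv] using hXv
    obtain ⟨Z', hZ', hZ'g, hZ'v, hZ'c⟩ := hK.strong_elim hZ (hK.neg_mem W hW) (e := g) (f := v)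
      (by rwa [hZg]) (by simp [hZg]) hZv0 (by simpa using hWv)
    simp only [Pi.neg_apply] at hZ'c
    refine ih _ ?_ hZ' ?_ ?_ ?_ rfl
    · rw [← hn]
      refine Finset.card_lt_card (Finset.ssubset_iff_subset_ne.2 ⟨?_, ?_⟩)
      · intro k
        simp only [Finset.mem_filter, Finset.mem_univ, true_and]
        have h1 := hZ'c k
        have h2 := hWc k
        revert h1 h2
        generalize Z' k = a, W k = b, X k = c, Z k = d; decide +revert
      · intro h
        have := Finset.ext_iff.1 h g
        simp only [Finset.mem_filter, Finset.mem_univ, true_and] at this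
        rcases this.2 (Or.inr (hZg ▸ hWg)) with h | h
        · exact h hXg
        · exact h hZ'g
    · intro k hk
      rcases hZ'c k hk with h | h
      · exact hZS k (h ▸ hk)
      · exact Or.inr (hWS k fun h0 => hk (by simp [h, h0]))
    · have := hZ'c v
      revert this hZ'v hWv hZv
      generalize Z' v = a, W v = b, X v = c, Z v = d; decide +revert
    · intro k hkv
      have h1 := hZY k hkv
      have h2 := hWY k
      have h3 := hZ'c k
      revert h1 h2 h3
      generalize Z' k = a, W k = b, Y k = c, Z k = d; decide +revert

/-- A covector of a restriction extends to one more element. -/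
theorem exists_extend_insert [Fintype V] (hK : IsSignedCircuits K) {S : Set V}
    {Y : V → SignType} (hY : Y ∈ covectors K S) {v : V} (hv : v ∉ S) :
    ∃ Y' ∈ covectors K (insert v S), ∀ k ∈ S, Y' k = Y k := by
  classical
  by_contra! hcon
  have bad : ∀ s : SignType, ∃ C ∈ K, (∀ k, C k ≠ 0 → k = v ∨ k ∈ S) ∧ C v ≠ 0 ∧
      (∃ k, Function.update Y v s k * C k = 1) ∧
      ∀ k, Function.update Y v s k * C k ≠ -1 := by
    intro s
    have hs : Function.update Y v s ∉ covectors K (insert v S) := fun h => by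
      obtain ⟨k, hk, hne⟩ := hcon _ h
      exact hne (Function.update_of_ne (by rintro rfl; exact hv hk) _ _)
    simp only [covectors, Set.mem_ofPred_eq, not_forall, not_exists] at hs
    obtain ⟨C, hC, hCS, k, hk, hj⟩ := hs
    refine ⟨C, hC, hCS, fun hCv => ?_, ⟨k, hk⟩, hj⟩
    have key : ∀ j, Function.update Y v s j * C j = Y j * C j := by
      intro j
      by_cases hjv : j = v
      · subst hjv; simp [hCv]
      · rw [Function.update_of_ne hjv]
    simp only [key] at hk hj
    obtain ⟨j, hj'⟩ := hY C hC (fun i hi => (hCS i hi).resolve_left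
      (by rintro rfl; exact hi hCv)) k hk
    exact hj j hj'
  obtain ⟨X, hX, hXS, hXv, ⟨f, hf⟩, hXY⟩ := bad 0
  have hfv : f ≠ v := by rintro rfl; simp at hf
  obtain ⟨Z, hZ, hZS, hZv, -, hZY⟩ := bad (-X v)
  refine hK.no_conflict hY hX hXS hXv (fun k hk => ?_) hfv ?_ hZ hZS ?_ (fun k hk => ?_)
  · have := hXY k
    rwa [Function.update_of_ne hk] at this
  · rwa [Function.update_of_ne hfv] at hf
  · have := hZY v
    rw [Function.update_self] at this
    revert this hXv hZv
    generalize X v = a, Z v = b; decide +revert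
  · have := hZY k
    rwa [Function.update_of_ne hk] at this

/-- Covectors of a restriction extend to covectors. -/
theorem exists_extend [Fintype V] (hK : IsSignedCircuits K) {S : Set V} {Y : V → SignType}
    (hY : Y ∈ covectors K S) : ∃ Y' ∈ covectors K Set.univ, ∀ k ∈ S, Y' k = Y k := by
  classical
  have key : ∀ D : Finset V, ∃ Y' ∈ covectors K (S ∪ D), ∀ k ∈ S, Y' k = Y k := by
    intro D
    induction D using Finset.induction_on with
    | empty => exact ⟨Y, by simpa using hY, fun _ _ => rfl⟩
    | insert v D _ ih =>
      obtain ⟨Y', hY', h⟩ := ih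
      rw [Finset.coe_insert, Set.union_insert]
      by_cases hv : v ∈ S ∪ D
      · rw [Set.insert_eq_of_mem hv]
        exact ⟨Y', hY', h⟩
      · obtain ⟨Y'', hY'', h'⟩ := hK.exists_extend_insert hY' hv
        exact ⟨Y'', hY'', fun k hk => (h' k (Or.inl hk)).trans (h k hk)⟩
  simpa using key Finset.univ

/-- Two covectors agreeing on `T` and of opposite signs at `v` can be interpolated by a covector
vanishing at `v`. -/
theorem exists_eq_zero_of_opposite [Fintype V] (hK : IsSignedCircuits K) {T : Set V}
    {Y Z : V → SignType} (hY : Y ∈ covectors K Set.univ) (hZ : Z ∈ covectors K Set.univ)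
    (hYZ : ∀ k ∈ T, Y k = Z k) {v : V} (hYv : Y v = 1) (hZv : Z v = -1) :
    ∃ W ∈ covectors K Set.univ, W v = 0 ∧ ∀ k ∈ T, W k = Y k := by
  classical
  have hvT : v ∉ T := fun h => by
    have := hYZ v h
    rw [hYv, hZv] at this
    exact absurd this (by decide)
  have hq : Function.update Y v 0 ∈ covectors K (insert v T) := by
    intro C hC hCT k hk
    have hkv : k ≠ v := by rintro rfl; simp at hk
    rw [Function.update_of_ne hkv] at hk
    have hkT : k ∈ T := (hCT k (fun h => by simp [h] at hk)).resolve_left hkv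
    have main : ∃ j, j ≠ v ∧ Y j * C j = -1 := by
      rcases SignType.trichotomy (C v) with h | h | h
      · obtain ⟨j, hj⟩ := hZ C hC (fun _ _ => trivial) k (hYZ k hkT ▸ hk)
        have hjv : j ≠ v := by
          rintro rfl
          rw [h, hZv] at hj
          exact absurd hj (by decide)
        have hjT : j ∈ T := (hCT j (fun h => by simp [h] at hj)).resolve_left hjv
        exact ⟨j, hjv, hYZ j hjT ▸ hj⟩
      · obtain ⟨j, hj⟩ := hY C hC (fun _ _ => trivial) k hk
        exact ⟨j, by rintro rfl; simp [h] at hj, hj⟩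
      · obtain ⟨j, hj⟩ := hY C hC (fun _ _ => trivial) k hk
        refine ⟨j, ?_, hj⟩
        rintro rfl
        rw [h, hYv] at hj
        exact absurd hj (by decide)
    obtain ⟨j, hjv, hj⟩ := main
    exact ⟨j, by rwa [Function.update_of_ne hjv]⟩
  obtain ⟨W, hW, h⟩ := hK.exists_extend hq
  refine ⟨W, hW, by simp [h v (Set.mem_insert _ _)], fun k hk => ?_⟩
  rw [h k (Set.mem_insert_of_mem _ hk), Function.update_of_ne (by rintro rfl; exact hvT hk)]

end IsSignedCircuits

section Homology

variable {α : Type*}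

/-- The chain `c` is a combination of `m`-element members of `K`. -/
def IsChainIn (K : Set (Finset α)) (m : ℕ) (c : Finset α → ZMod 2) : Prop :=
  ∀ t, c t ≠ 0 → t ∈ K ∧ t.card = m

namespace IsChainIn

variable {K L : Set (Finset α)} {m : ℕ} {c d : Finset α → ZMod 2}

theorem zero : IsChainIn K m 0 := fun _ h => absurd rfl h

theorem add (hc : IsChainIn K m c) (hd : IsChainIn K m d) : IsChainIn K m (c + d) := by
  intro t ht
  by_cases h : c t = 0
  · exact hd t fun h' => ht (by simp [h, h'])
  · exact hc t h

theorem mono (hc : IsChainIn K m c) (h : ∀ t ∈ K, t ∈ L) : IsChainIn L m c :=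
  fun t ht => ⟨h t (hc t ht).1, (hc t ht).2⟩

/-- A chain in a union of two complexes splits. -/
theorem exists_eq_add {K₁ K₂ : Set (Finset α)} (hK : ∀ t ∈ K, t ∈ K₁ ∨ t ∈ K₂)
    (hc : IsChainIn K m c) :
    ∃ c₁ c₂, c = c₁ + c₂ ∧ IsChainIn K₁ m c₁ ∧ IsChainIn K₂ m c₂ := by
  classical
  refine ⟨fun t => if t ∈ K₁ then c t else 0, fun t => if t ∈ K₁ then 0 else c t, ?_, ?_, ?_⟩
  · ext t; by_cases h : t ∈ K₁ <;> simp [h]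
  · intro t ht
    by_cases h : t ∈ K₁
    · simp only [h, if_true] at ht
      exact ⟨h, (hc t ht).2⟩
    · simp [h] at ht
  · intro t ht
    by_cases h : t ∈ K₁
    · simp [h] at ht
    · simp only [h, if_false] at ht
      exact ⟨(hK t (hc t ht).1).resolve_left h, (hc t ht).2⟩

end IsChainIn

variable [DecidableEq α]

/-- The cone with apex `x` over a chain. -/
def chainCone (x : α) (c : Finset α → ZMod 2) (t : Finset α) : ZMod 2 :=
  if x ∈ t then c (t.erase x) else 0

/-- A chain splits into the part avoiding `x` and the cone over a chain in the link of `x`. -/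
theorem IsChainIn.exists_eq_add_cone {K L D : Set (Finset α)} {m : ℕ} {c : Finset α → ZMod 2}
    (hc : IsChainIn K m c) (x : α)
    (hD : ∀ t ∈ K, x ∉ t → t ∈ D) (hL : ∀ t, x ∉ t → insert x t ∈ K → t ∈ L) :
    ∃ a b, c = a + chainCone x b ∧ IsChainIn D m a ∧ (∀ t, x ∈ t → a t = 0) ∧
      (∀ t, b t ≠ 0 → t ∈ L ∧ t.card + 1 = m) ∧ ∀ t, x ∈ t → b t = 0 := by
  refine ⟨fun t => if x ∈ t then 0 else c t, fun t => if x ∈ t then 0 else c (insert x t),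
    ?_, ?_, ?_, ?_, ?_⟩
  · ext t
    by_cases hx : x ∈ t <;> simp [chainCone, hx, Finset.insert_erase]
  · intro t ht
    by_cases hx : x ∈ t
    · simp [hx] at ht
    · simp only [hx, if_false] at ht
      exact ⟨hD t (hc t ht).1 hx, (hc t ht).2⟩
  · intro t hx; simp [hx]
  · intro t ht
    by_cases hx : x ∈ t
    · simp [hx] at ht
    · simp only [hx, if_false] at ht
      refine ⟨hL t hx (hc _ ht).1, ?_⟩
      rw [← (hc _ ht).2, Finset.card_insert_of_notMem hx]
  · intro t hx; simp [hx]

variable [Fintype α]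

/-- The boundary of a simplicial chain modulo two, chains being functions on all finite sets. -/
def chainBdry (c : Finset α → ZMod 2) (t : Finset α) : ZMod 2 :=
  ∑ v ∈ Finset.univ.filter (· ∉ t), c (insert v t)

/-- The chain `c` is the boundary of a chain of `(m + 1)`-element members of `K`. -/
def BoundsIn (K : Set (Finset α)) (m : ℕ) (c : Finset α → ZMod 2) : Prop :=
  ∃ d, IsChainIn K (m + 1) d ∧ chainBdry d = c

/-- Every cycle made of `m`-element members of `K` with `m < n` bounds in `K`. -/
def AcyclicBelow (K : Set (Finset α)) (n : ℕ) : Prop :=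
  ∀ m < n, ∀ c, IsChainIn K m c → chainBdry c = 0 → BoundsIn K m c

theorem AcyclicBelow.mono {K : Set (Finset α)} {m n : ℕ} (h : AcyclicBelow K n) (hmn : m ≤ n) :
    AcyclicBelow K m :=
  fun l hl => h l (hl.trans_le hmn)

theorem chainBdry_add (c d : Finset α → ZMod 2) :
    chainBdry (c + d) = chainBdry c + chainBdry d := by
  ext t; simp [chainBdry, Finset.sum_add_distrib]

@[simp] theorem chainBdry_zero : chainBdry (0 : Finset α → ZMod 2) = 0 := by
  ext t; simp [chainBdry]

theorem chain_add_self {β : Type*} (c : β → ZMod 2) : c + c = 0 := by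
  ext t; exact CharTwo.add_self_eq_zero _

theorem chain_add_eq_zero_iff {β : Type*} {c d : β → ZMod 2} : c + d = 0 ↔ c = d := by
  constructor
  · intro h
    calc c = c + (d + d) := by rw [chain_add_self, add_zero]
      _ = d := by rw [← add_assoc, h, zero_add]
  · rintro rfl; exact chain_add_self c

theorem chainBdry_chainBdry (c : Finset α → ZMod 2) : chainBdry (chainBdry c) = 0 := by
  ext t
  simp only [chainBdry, Pi.zero_apply]
  rw [Finset.sum_sigma']
  refine Finset.sum_involution (fun p _ => ⟨p.2, p.1⟩) ?_ ?_ ?_ ?_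
  · rintro ⟨v, w⟩ _
    simp only
    rw [Finset.insert_comm]
    exact CharTwo.add_self_eq_zero _
  · rintro ⟨v, w⟩ h _ heq
    simp only [Finset.mem_sigma, Finset.mem_filter, Finset.mem_univ, true_and,
      Finset.mem_insert, not_or] at h
    simp only [Sigma.mk.injEq, heq_eq_eq] at heq
    exact h.2.1 heq.1
  · rintro ⟨v, w⟩ h
    simp only [Finset.mem_sigma, Finset.mem_filter, Finset.mem_univ, true_and,
      Finset.mem_insert, not_or] at h ⊢
    exact ⟨h.2.2, fun h' => h.2.1 h'.symm, h.1⟩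
  · rintro ⟨v, w⟩ _
    rfl

theorem chainBdry_chainCone (x : α) (c : Finset α → ZMod 2) :
    chainBdry (chainCone x c) = c + chainCone x (chainBdry c) := by
  ext t
  rw [Pi.add_apply]
  by_cases hx : x ∈ t
  · have h1 : (Finset.univ.filter fun v => v ∉ t.erase x) =
        insert x (Finset.univ.filter fun v => v ∉ t) := by
      ext v
      simp only [Finset.mem_filter, Finset.mem_univ, true_and, Finset.mem_erase,
        Finset.mem_insert]
      tauto
    have h2 : chainCone x (chainBdry c) t =
        c t + ∑ v ∈ Finset.univ.filter (· ∉ t), c (insert v (t.erase x)) := by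
      simp only [chainCone, hx, if_true, chainBdry]
      rw [h1, Finset.sum_insert (by simpa using hx), Finset.insert_erase hx]
    rw [h2, ← add_assoc, CharTwo.add_self_eq_zero, zero_add, chainBdry]
    refine Finset.sum_congr rfl fun v hv => ?_
    have hvx : v ≠ x := by rintro rfl; simp [hx] at hv
    rw [chainCone, if_pos (Finset.mem_insert_of_mem hx), Finset.erase_insert_of_ne hvx]
  · rw [chainCone, if_neg hx, add_zero, chainBdry, Finset.sum_eq_single x]
    · rw [chainCone, if_pos (Finset.mem_insert_self _ _), Finset.erase_insert hx]
    · intro v _ hvx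
      rw [chainCone, if_neg]
      simp [hx, hvx.symm]
    · intro h
      simp [hx] at h

theorem IsChainIn.bdry {K : Set (Finset α)} {m : ℕ} {c : Finset α → ZMod 2}
    (hK : ∀ t ∈ K, ∀ s ⊆ t, s ∈ K) (hc : IsChainIn K (m + 1) c) :
    IsChainIn K m (chainBdry c) := by
  intro t ht
  obtain ⟨v, hv, hcv⟩ := Finset.exists_ne_zero_of_sum_ne_zero ht
  have hvt : v ∉ t := by simpa using hv
  obtain ⟨h1, h2⟩ := hc _ hcv
  rw [Finset.card_insert_of_notMem hvt] at h2
  exact ⟨hK _ h1 _ (Finset.subset_insert _ _), by omega⟩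

theorem chainBdry_eq_zero_of_mem {c : Finset α → ZMod 2} {x : α} (hc : ∀ t, x ∈ t → c t = 0)
    {t : Finset α} (ht : x ∈ t) : chainBdry c t = 0 :=
  Finset.sum_eq_zero fun _ _ => hc _ (Finset.mem_insert_of_mem ht)

/-- Comparing the parts of `∂(a + x * b) = c` with and without `x`. -/
theorem chainBdry_add_cone_eq {a b c : Finset α → ZMod 2} {x : α} (ha : ∀ t, x ∈ t → a t = 0)
    (hb : ∀ t, x ∈ t → b t = 0) (hc : ∀ t, x ∈ t → c t = 0)
    (h : chainBdry (a + chainCone x b) = c) : chainBdry b = 0 ∧ chainBdry a + b = c := by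
  rw [chainBdry_add, chainBdry_chainCone] at h
  have hb0 : chainBdry b = 0 := by
    ext t
    by_cases hx : x ∈ t
    · exact chainBdry_eq_zero_of_mem hb hx
    · have := congrFun h (insert x t)
      have hmem := Finset.mem_insert_self x t
      simpa [chainBdry_eq_zero_of_mem ha hmem, hb _ hmem, hc _ hmem, chainCone,
        Finset.erase_insert hx] using this
  refine ⟨hb0, ?_⟩
  have h0 : chainCone x (0 : Finset α → ZMod 2) = 0 := by ext t; simp [chainCone]
  rw [← h, hb0, h0, add_zero]

/-- Gluing the star of a vertex `x` along an acyclic link preserves acyclicity. -/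
theorem acyclicBelow_of_link {K D L : Set (Finset α)} (x : α) (hDK : ∀ t ∈ D, t ∈ K)
    (hKD : ∀ t ∈ K, x ∉ t → t ∈ D) (hKL : ∀ t, x ∉ t → insert x t ∈ K → t ∈ L)
    (hL : ∀ t ∈ L, x ∉ t ∧ insert x t ∈ K ∧ t ∈ D) {n : ℕ} (hDn : AcyclicBelow D (n + 1))
    (hLn : AcyclicBelow L n) : AcyclicBelow K (n + 1) := by
  intro m hm c hc hc0
  obtain ⟨a, b, rfl, ha, ha0, hb, hb0⟩ := hc.exists_eq_add_cone x hKD hKL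
  obtain ⟨hbz, hab⟩ := chainBdry_add_cone_eq ha0 hb0 (fun _ _ => rfl) hc0
  obtain ⟨d, hd, hdb⟩ : ∃ d, IsChainIn L m d ∧ chainBdry d = b := by
    cases m with
    | zero =>
      refine ⟨0, IsChainIn.zero, ?_⟩
      ext t
      by_contra h
      have := (hb t fun h' => h (by simp [h'])).2
      omega
    | succ m =>
      exact hLn m (by omega) b (fun t ht => ⟨(hb t ht).1, by have := (hb t ht).2; omega⟩) hbz
  obtain ⟨e, he, hea⟩ := hDn m hm (a + d) (ha.add (hd.mono fun t ht => (hL t ht).2.2))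
    (by rw [chainBdry_add, hdb, hab]; rfl)
  refine ⟨e + chainCone x d, (he.mono hDK).add ?_, ?_⟩
  · intro t ht
    have hx : x ∈ t := by by_contra hx; simp [chainCone, hx] at ht
    simp only [chainCone, hx, if_true] at ht
    obtain ⟨h1, h2⟩ := hd _ ht
    have := hL _ h1
    rw [Finset.insert_erase hx] at this
    refine ⟨this.2.1, ?_⟩
    rw [← Finset.card_erase_add_one hx, h2]
  · rw [chainBdry_add, hea, chainBdry_chainCone, hdb, add_assoc, ← add_assoc d, chain_add_self,
      zero_add]

/-- If the link of `x` is acyclic, deleting `x` creates no new nontrivial cycles. -/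
theorem BoundsIn.of_link {K D L : Set (Finset α)} (x : α)
    (hKD : ∀ t ∈ K, x ∉ t → t ∈ D) (hKL : ∀ t, x ∉ t → insert x t ∈ K → t ∈ L)
    (hLD : ∀ t ∈ L, t ∈ D) (hLn : ∀ n, AcyclicBelow L n) {m : ℕ} {c : Finset α → ZMod 2}
    (hcx : ∀ t, x ∈ t → c t = 0) (hc : BoundsIn K m c) : BoundsIn D m c := by
  obtain ⟨d, hd, hdc⟩ := hc
  obtain ⟨a, b, rfl, ha, ha0, hb, hb0⟩ := hd.exists_eq_add_cone x hKD hKL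
  obtain ⟨hbz, hab⟩ := chainBdry_add_cone_eq ha0 hb0 hcx hdc
  obtain ⟨e, he, heb⟩ := hLn (m + 1) m (by omega) b
    (fun t ht => ⟨(hb t ht).1, by have := (hb t ht).2; omega⟩) hbz
  exact ⟨a + e, ha.add (he.mono hLD), by rw [chainBdry_add, heb, hab]⟩

theorem acyclicBelow_of_cone {K : Set (Finset α)} (x : α) (hx : ∀ t ∈ K, insert x t ∈ K)
    (n : ℕ) : AcyclicBelow K n := by
  intro m _ c hc hc0
  refine ⟨chainCone x c, ?_, ?_⟩
  · intro t ht
    have hxt : x ∈ t := by by_contra hx; simp [chainCone, hx] at ht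
    simp only [chainCone, hxt, if_true] at ht
    obtain ⟨h1, h2⟩ := hc _ ht
    have := hx _ h1
    rw [Finset.insert_erase hxt] at this
    exact ⟨this, by rw [← Finset.card_erase_add_one hxt, h2]⟩
  · rw [chainBdry_chainCone, hc0]
    ext t; simp [chainCone]

theorem acyclicBelow_of_isEmpty {K : Set (Finset α)} (hK : ∀ t, t ∉ K) (n : ℕ) :
    AcyclicBelow K n :=
  fun m _ c hc _ => ⟨0, IsChainIn.zero, by
    ext t
    by_contra h
    exact hK t (hc t fun h' => h (by simp [h'])).1⟩

/-- Mayer–Vietoris: a union of two acyclic complexes with acyclic intersection is acyclic. -/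
theorem acyclicBelow_union {K K₁ K₂ K₀ : Set (Finset α)} (hK : ∀ t ∈ K, t ∈ K₁ ∨ t ∈ K₂)
    (h₁ : ∀ t ∈ K₁, t ∈ K) (h₂ : ∀ t ∈ K₂, t ∈ K) (h₀ : ∀ t, t ∈ K₀ ↔ t ∈ K₁ ∧ t ∈ K₂)
    (hd₁ : ∀ t ∈ K₁, ∀ s ⊆ t, s ∈ K₁) (hd₂ : ∀ t ∈ K₂, ∀ s ⊆ t, s ∈ K₂) {n : ℕ}
    (ha₁ : AcyclicBelow K₁ n) (ha₂ : AcyclicBelow K₂ n) (ha₀ : AcyclicBelow K₀ n) :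
    AcyclicBelow K n := by
  intro m hm c hc hc0
  obtain ⟨c₁, c₂, rfl, hc₁, hc₂⟩ := hc.exists_eq_add hK
  rw [chainBdry_add, chain_add_eq_zero_iff] at hc0
  obtain ⟨f, hf, hfc⟩ : ∃ f, IsChainIn K₀ m f ∧ chainBdry f = chainBdry c₁ := by
    cases m with
    | zero =>
      refine ⟨0, IsChainIn.zero, ?_⟩
      ext t
      rw [chainBdry_zero, Pi.zero_apply, chainBdry, Finset.sum_eq_zero]
      intro v _
      by_contra h
      have := (hc₁ _ h).2
      simp at this
    | succ m =>
      refine ha₀ m (by omega) _ (fun t ht => ⟨(h₀ t).2 ⟨?_, ?_⟩, ?_⟩) (chainBdry_chainBdry _)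
      · exact (hc₁.bdry hd₁ t ht).1
      · exact (hc₂.bdry hd₂ t (hc0 ▸ ht)).1
      · exact (hc₁.bdry hd₁ t ht).2
  obtain ⟨g₁, hg₁, hgc₁⟩ := ha₁ m hm (c₁ + f) (hc₁.add (hf.mono fun t ht => ((h₀ t).1 ht).1))
    (by rw [chainBdry_add, hfc, chain_add_self])
  obtain ⟨g₂, hg₂, hgc₂⟩ := ha₂ m hm (c₂ + f) (hc₂.add (hf.mono fun t ht => ((h₀ t).1 ht).2))
    (by rw [chainBdry_add, hfc, hc0, chain_add_self])
  refine ⟨g₁ + g₂, (hg₁.mono h₁).add (hg₂.mono h₂), ?_⟩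
  rw [chainBdry_add, hgc₁, hgc₂, add_add_add_comm, chain_add_self, add_zero]

/-- Suspension: a nontrivial cycle in the intersection of two acyclic complexes gives a nontrivial
cycle of one dimension more in their union. -/
theorem exists_not_boundsIn_union {K K₁ K₂ K₀ : Set (Finset α)}
    (hK : ∀ t ∈ K, t ∈ K₁ ∨ t ∈ K₂)
    (h₁ : ∀ t ∈ K₁, t ∈ K) (h₂ : ∀ t ∈ K₂, t ∈ K) (h₀ : ∀ t, t ∈ K₀ ↔ t ∈ K₁ ∧ t ∈ K₂)
    (hd₁ : ∀ t ∈ K₁, ∀ s ⊆ t, s ∈ K₁) (hd₂ : ∀ t ∈ K₂, ∀ s ⊆ t, s ∈ K₂)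
    (ha₁ : ∀ n, AcyclicBelow K₁ n) (ha₂ : ∀ n, AcyclicBelow K₂ n) {m : ℕ}
    (h : ∃ c, IsChainIn K₀ m c ∧ chainBdry c = 0 ∧ ¬ BoundsIn K₀ m c) :
    ∃ c, IsChainIn K (m + 1) c ∧ chainBdry c = 0 ∧ ¬ BoundsIn K (m + 1) c := by
  obtain ⟨c, hc, hc0, hcb⟩ := h
  obtain ⟨d₁, hd₁', hdc₁⟩ := ha₁ (m + 1) m (by omega) c
    (hc.mono fun t ht => ((h₀ t).1 ht).1) hc0
  obtain ⟨d₂, hd₂', hdc₂⟩ := ha₂ (m + 1) m (by omega) c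
    (hc.mono fun t ht => ((h₀ t).1 ht).2) hc0
  refine ⟨d₁ + d₂, (hd₁'.mono h₁).add (hd₂'.mono h₂), ?_, ?_⟩
  · rw [chainBdry_add, hdc₁, hdc₂, chain_add_self]
  · rintro ⟨w, hw, hwd⟩
    obtain ⟨w₁, w₂, rfl, hw₁, hw₂⟩ := hw.exists_eq_add hK
    rw [chainBdry_add] at hwd
    have heq : d₁ + chainBdry w₁ = d₂ + chainBdry w₂ := by
      rw [← chain_add_eq_zero_iff, add_add_add_comm, hwd, chain_add_self]
    have he₁ := hd₁'.add (hw₁.bdry hd₁)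
    have he₂ := hd₂'.add (hw₂.bdry hd₂)
    refine hcb ⟨d₁ + chainBdry w₁, fun t ht => ⟨(h₀ t).2 ⟨(he₁ t ht).1, ?_⟩, (he₁ t ht).2⟩, ?_⟩
    · rw [heq] at ht
      exact (he₂ t ht).1
    · rw [chainBdry_add, chainBdry_chainBdry, add_zero, hdc₁]

end Homology

section Clique

variable {β : Type*}

/-- The members of the family `I` contained in `W` whose elements are pairwise related. -/
def cliqueCpx (R : β → β → Prop) (I : Finset β → Prop) (W : Set β) : Set (Finset β) :=
  {t | (∀ x ∈ t, x ∈ W) ∧ (∀ x ∈ t, ∀ y ∈ t, R x y) ∧ I t}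

/-- The elements of `W` other than `x` related to `x`. -/
def neighbors (R : β → β → Prop) (W : Set β) (x : β) : Set β := {w | w ∈ W ∧ w ≠ x ∧ R w x}

variable {R : β → β → Prop} {I : Finset β → Prop} {W : Set β}

theorem subset_mem_cliqueCpx (hI : ∀ s t, s ⊆ t → I t → I s) {s t : Finset β}
    (ht : t ∈ cliqueCpx R I W) (hst : s ⊆ t) : s ∈ cliqueCpx R I W :=
  ⟨fun x hx => ht.1 x (hst hx), fun x hx y hy => ht.2.1 x (hst hx) y (hst hy), hI s t hst ht.2.2⟩

theorem mem_cliqueCpx_sdiff {x : β} {t : Finset β} (ht : t ∈ cliqueCpx R I W) (hxt : x ∉ t) :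
    t ∈ cliqueCpx R I (W \ {x}) :=
  ⟨fun y hy => ⟨ht.1 y hy, fun h : y = x => hxt (h ▸ hy)⟩, ht.2⟩

variable [DecidableEq β]

theorem mem_cliqueCpx_of_insert {x : β} (hI : ∀ s t, s ⊆ t → I t → I s) {t : Finset β}
    (hxt : x ∉ t) (ht : insert x t ∈ cliqueCpx R I W) :
    t ∈ cliqueCpx R (fun s => x ∉ s ∧ I (insert x s)) (neighbors R W x) := by
  refine ⟨fun y hy => ⟨ht.1 y (Finset.mem_insert_of_mem hy), ?_, ?_⟩, ?_, hxt, ht.2.2⟩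
  · rintro rfl; exact hxt hy
  · exact ht.2.1 y (Finset.mem_insert_of_mem hy) x (Finset.mem_insert_self x t)
  · exact (subset_mem_cliqueCpx hI ht (Finset.subset_insert x t)).2.1

theorem mem_cliqueCpx_of_link {x : β} (hI : ∀ s t, s ⊆ t → I t → I s) {t : Finset β}
    (ht : t ∈ cliqueCpx R (fun s => x ∉ s ∧ I (insert x s)) (neighbors R W x)) :
    t ∈ cliqueCpx R I (W \ {x}) :=
  ⟨fun y hy => ⟨(ht.1 y hy).1, (ht.1 y hy).2.1⟩, ht.2.1,
    hI _ _ (Finset.subset_insert x t) ht.2.2.2⟩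

theorem insert_mem_cliqueCpx {x : β} (hr : ∀ x, R x x) (hs : ∀ x y, R x y → R y x) (hx : x ∈ W)
    {t : Finset β}
    (ht : t ∈ cliqueCpx R (fun s => x ∉ s ∧ I (insert x s)) (neighbors R W x)) :
    insert x t ∈ cliqueCpx R I W := by
  refine ⟨?_, ?_, ht.2.2.2⟩
  · intro y hy
    rcases Finset.mem_insert.1 hy with h | hy
    exacts [h ▸ hx, (ht.1 y hy).1]
  · intro y hy z hz
    rcases Finset.mem_insert.1 hy with h | hy <;> rcases Finset.mem_insert.1 hz with h' | hz
    · rw [h, h']; exact hr x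
    · rw [h]; exact hs _ _ (ht.1 z hz).2.2
    · rw [h']; exact (ht.1 y hy).2.2
    · exact ht.2.1 y hy z hz

theorem acyclicBelow_cliqueCpx_of_link [Fintype β] (hr : ∀ x, R x x) (hs : ∀ x y, R x y → R y x)
    (hI : ∀ s t, s ⊆ t → I t → I s) {x : β} (hx : x ∈ W) {n : ℕ}
    (hD : AcyclicBelow (cliqueCpx R I (W \ {x})) (n + 1))
    (hL : AcyclicBelow (cliqueCpx R (fun s => x ∉ s ∧ I (insert x s)) (neighbors R W x)) n) :
    AcyclicBelow (cliqueCpx R I W) (n + 1) := by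
  refine acyclicBelow_of_link x ?_ ?_ (fun t hxt ht => mem_cliqueCpx_of_insert hI hxt ht)
    (fun t ht => ⟨ht.2.2.1, insert_mem_cliqueCpx hr hs hx ht, mem_cliqueCpx_of_link hI ht⟩) hD hL
  · exact fun t ht => ⟨fun y hy => (ht.1 y hy).1, ht.2⟩
  · exact fun t ht hxt => mem_cliqueCpx_sdiff ht hxt

theorem cliqueCpx_neighbors_eq (hI : ∀ s t, s ⊆ t → I t → I s) {x : β}
    (hx : ∀ s, I s → I (insert x s)) :
    cliqueCpx R (fun s => x ∉ s ∧ I (insert x s)) (neighbors R W x) =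
      cliqueCpx R I (neighbors R W x) := by
  ext t
  refine ⟨fun h => ⟨h.1, h.2.1, hI _ _ (Finset.subset_insert x t) h.2.2.2⟩,
    fun h => ⟨h.1, h.2.1, fun hxt => (h.1 x hxt).2.1 rfl, hx _ h.2.2⟩⟩

/-- Adjoining vertices whose links in `U` are acyclic in one degree less, and nested along
related vertices, preserves acyclicity. -/
theorem acyclicBelow_cliqueCpx_union [Fintype β] (hr : ∀ x, R x x) (hs : ∀ x y, R x y → R y x)
    (hI : ∀ s t, s ⊆ t → I t → I s) (F : Finset β) (hF : ∀ x ∈ F, ∀ s, I s → I (insert x s))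
    {U : Set β} (hFU : ∀ x ∈ F, x ∉ U) {n : ℕ} (hU : AcyclicBelow (cliqueCpx R I U) (n + 1))
    (hn : ∀ x ∈ F, AcyclicBelow (cliqueCpx R I (neighbors R U x)) n)
    (hc : ∀ x ∈ F, ∀ y ∈ F, R x y →
      neighbors R U x ⊆ neighbors R U y ∨ neighbors R U y ⊆ neighbors R U x) :
    AcyclicBelow (cliqueCpx R I (F ∪ U)) (n + 1) := by
  classical
  induction F using Finset.strongInduction generalizing U n with | _ F ih
  rcases F.eq_empty_or_nonempty with rfl | ⟨x, hx⟩
  · simpa using hU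
  have hxU := hFU x hx
  refine acyclicBelow_cliqueCpx_of_link hr hs hI (x := x) (Or.inl hx) ?_ ?_
  · have := ih (F.erase x) (Finset.erase_ssubset hx)
      (fun y hy => hF y (Finset.mem_of_mem_erase hy))
      (fun y hy => hFU y (Finset.mem_of_mem_erase hy)) hU
      (fun y hy => hn y (Finset.mem_of_mem_erase hy))
      (fun y hy z hz => hc y (Finset.mem_of_mem_erase hy) z (Finset.mem_of_mem_erase hz))
    convert this using 2
    ext y
    simp only [Set.mem_sdiff, Set.mem_union, Finset.mem_coe, Set.mem_singleton_iff,
      Finset.mem_erase]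
    constructor
    · rintro ⟨h | h, h'⟩
      exacts [Or.inl ⟨h', h⟩, Or.inr h]
    · rintro (⟨h', h⟩ | h)
      exacts [⟨Or.inl h, h'⟩, ⟨Or.inr h, by rintro rfl; exact hxU h⟩]
  · rw [cliqueCpx_neighbors_eq hI (hF x hx)]
    rcases n with _ | n
    · exact fun m hm => absurd hm (Nat.not_lt_zero m)
    have hsub : (F.erase x).filter (R · x) ⊂ F :=
      (Finset.filter_subset _ _).trans_ssubset (Finset.erase_ssubset hx)
    have hnb : ∀ y, neighbors R (neighbors R U x) y = neighbors R U x ∩ neighbors R U y := by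
      intro y; ext z; simp only [neighbors, Set.mem_ofPred_eq, Set.mem_inter_iff]; tauto
    have := ih _ hsub (fun y hy => hF y (hsub.1 hy)) (U := neighbors R U x)
      (fun y hy h => hFU y (hsub.1 hy) h.1) (hn x hx) (fun y hy => ?_) (fun y hy z hz hyz => ?_)
    · convert this using 2
      ext y
      simp only [neighbors, Set.mem_ofPred_eq, Set.mem_union, Finset.mem_coe, Finset.mem_filter,
        Finset.mem_erase]
      tauto
    · rw [hnb]
      rcases hc x hx y (hsub.1 hy) (hs _ _ (Finset.mem_filter.1 hy).2) with h | h
      · rw [Set.inter_eq_left.2 h]; exact (hn x hx).mono n.le_succ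
      · rw [Set.inter_eq_right.2 h]; exact (hn y (hsub.1 hy)).mono n.le_succ
    · rw [hnb, hnb]
      exact (hc y (hsub.1 hy) z (hsub.1 hz) hyz).imp
        (Set.inter_subset_inter_right _) (Set.inter_subset_inter_right _)

end Clique

section Covectors

variable {V : Type*}

/-- The conformal order on sign vectors. -/
def Conforms (Y Z : V → SignType) : Prop := ∀ k, Y k ≠ 0 → Y k = Z k

theorem Conforms.trans {X Y Z : V → SignType} (h : Conforms X Y) (h' : Conforms Y Z) :
    Conforms X Z := fun k hk => (h k hk).trans (h' k (h k hk ▸ hk))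

/-- Sign vectors are related when comparable in the conformal order, and a sign vector is related
to the elements of the ground set where it is not positive. -/
def SignRel : (V → SignType) ⊕ V → (V → SignType) ⊕ V → Prop
  | .inl Y, .inl Z => Conforms Y Z ∨ Conforms Z Y
  | .inl Y, .inr v => Y v ≠ 1
  | .inr v, .inl Y => Y v ≠ 1
  | .inr _, .inr _ => True

theorem signRel_refl (x : (V → SignType) ⊕ V) : SignRel x x := by
  rcases x with Y | v
  exacts [Or.inl fun _ _ => rfl, trivial]

theorem signRel_symm (x y : (V → SignType) ⊕ V) (h : SignRel x y) : SignRel y x := by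
  rcases x with Y | v <;> rcases y with Z | w
  exacts [Or.symm h, h, h, trivial]

/-- The order complex of a set of sign vectors under the conformal order. -/
abbrev orderCpx (S : Set (V → SignType)) : Set (Finset ((V → SignType) ⊕ V)) :=
  cliqueCpx SignRel (fun _ => True) (Sum.inl '' S)

/-- Sets of sign vectors closed under composition and under interpolation between opposite signs. -/
structure IsCovectorSet (L : Set (V → SignType)) : Prop where
  comp_mem : ∀ Y ∈ L, ∀ Z ∈ L, signComp Y Z ∈ L
  exists_eq_zero : ∀ Y ∈ L, ∀ Z ∈ L, ∀ T : Set V, (∀ k ∈ T, Y k = Z k) → ∀ v, Y v = 1 → Z v = -1 →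
    ∃ W ∈ L, W v = 0 ∧ ∀ k ∈ T, W k = Y k

/-- The members of `L` agreeing with `Y` on `T`. -/
def agreeing (L : Set (V → SignType)) (T : Set V) (Y : V → SignType) : Set (V → SignType) :=
  {Z | Z ∈ L ∧ ∀ k ∈ T, Z k = Y k}

theorem mem_orderCpx_iff {S : Set (V → SignType)} {t : Finset ((V → SignType) ⊕ V)} :
    t ∈ orderCpx S ↔ (∀ x ∈ t, ∃ Y ∈ S, Sum.inl Y = x) ∧ ∀ x ∈ t, ∀ y ∈ t, SignRel x y := by
  simp [cliqueCpx]

theorem orderCpx_mono {S S' : Set (V → SignType)} (h : S ⊆ S') :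
    ∀ t ∈ orderCpx S, t ∈ orderCpx S' :=
  fun _ ht => ⟨fun x hx => Set.image_mono h (ht.1 x hx), ht.2⟩

theorem orderCpx_subset {S : Set (V → SignType)} : ∀ t ∈ orderCpx S, ∀ s ⊆ t, s ∈ orderCpx S :=
  fun _ ht _ hs => subset_mem_cliqueCpx (fun _ _ _ h => h) ht hs

theorem mem_orderCpx_inter_iff {S₀ S₁ S₂ : Set (V → SignType)} (h : ∀ Y, Y ∈ S₀ ↔ Y ∈ S₁ ∧ Y ∈ S₂)
    (t : Finset ((V → SignType) ⊕ V)) : t ∈ orderCpx S₀ ↔ t ∈ orderCpx S₁ ∧ t ∈ orderCpx S₂ := by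
  refine ⟨fun ht => ⟨orderCpx_mono (fun Y hY => ((h Y).1 hY).1) t ht,
    orderCpx_mono (fun Y hY => ((h Y).1 hY).2) t ht⟩, fun ht => ⟨fun x hx => ?_, ht.1.2⟩⟩
  obtain ⟨Y, hY, rfl⟩ := ht.1.1 x hx
  obtain ⟨Z, hZ, hYZ⟩ := ht.2.1 _ hx
  exact ⟨Y, (h Y).2 ⟨hY, by rwa [← Sum.inl_injective hYZ]⟩, rfl⟩

/-- A chain of sign vectors cannot take both signs at `v`. -/
theorem mem_orderCpx_or {S : Set (V → SignType)} (v : V) {t : Finset ((V → SignType) ⊕ V)}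
    (ht : t ∈ orderCpx S) :
    t ∈ orderCpx {Y | Y ∈ S ∧ Y v ≠ -1} ∨ t ∈ orderCpx {Y | Y ∈ S ∧ Y v ≠ 1} := by
  by_contra! h
  have h₁ : ∃ Y, Sum.inl Y ∈ t ∧ Y v = -1 := by
    by_contra! h'
    refine h.1 ⟨fun x hx => ?_, ht.2⟩
    obtain ⟨Y, hY, rfl⟩ := ht.1 x hx
    exact ⟨Y, ⟨hY, h' Y hx⟩, rfl⟩
  have h₂ : ∃ Y, Sum.inl Y ∈ t ∧ Y v = 1 := by
    by_contra! h'
    refine h.2 ⟨fun x hx => ?_, ht.2⟩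
    obtain ⟨Y, hY, rfl⟩ := ht.1 x hx
    exact ⟨Y, ⟨hY, h' Y hx⟩, rfl⟩
  obtain ⟨Y, hY, hYv⟩ := h₁
  obtain ⟨Z, hZ, hZv⟩ := h₂
  rcases ht.2.1 _ hY _ hZ with h | h
  · have := h v (by rw [hYv]; decide)
    rw [hYv, hZv] at this; exact absurd this (by decide)
  · have := h v (by rw [hZv]; decide)
    rw [hYv, hZv] at this; exact absurd this (by decide)

variable [Fintype V] [DecidableEq V]

/-- A set of members of `L` containing those agreeing with `Y₀` on `T`, all of whose members
conform to `Y₀` on `T`, is acyclic when the sets of members agreeing with a given one are. -/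
theorem acyclicBelow_orderCpx_of_conforms {L : Set (V → SignType)} (hL : IsCovectorSet L)
    {T : Set V} {Y₀ : V → SignType} (hY₀ : Y₀ ∈ L) {S : Set (V → SignType)}
    (h₁ : ∀ Y ∈ S, Y ∈ L ∧ ∀ k ∈ T, Y k ≠ 0 → Y k = Y₀ k)
    (h₂ : ∀ Y ∈ L, (∀ k ∈ T, Y k = Y₀ k) → Y ∈ S)
    (hA : ∀ T', T ⊆ T' → ∀ Y ∈ L, ∀ n, AcyclicBelow (orderCpx (agreeing L T' Y)) n) (n : ℕ) :
    AcyclicBelow (orderCpx S) n := by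
  classical
  refine AcyclicBelow.mono (n := n + 1) ?_ n.le_succ
  set A := agreeing L T Y₀
  set U : Set ((V → SignType) ⊕ V) := Sum.inl '' A
  have hAS : A ⊆ S := fun Y hY => h₂ Y hY.1 hY.2
  have hnb : ∀ Y ∈ S, Y ∉ A → ∀ Z, Z ∈ neighbors SignRel U (Sum.inl Y) ↔
      ∃ X, X ∈ A ∧ Conforms Y X ∧ Sum.inl X = Z := by
    intro Y hY hYA Z
    constructor
    · rintro ⟨⟨X, hX, rfl⟩, -, h | h⟩
      · refine absurd ⟨(h₁ Y hY).1, fun k hk => ?_⟩ hYA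
        by_cases hXk : X k = 0
        · rw [hX.2 k hk] at hXk
          by_contra h'
          exact h' ((h₁ Y hY).2 k hk fun h0 => h' (h0.trans hXk.symm))
        · rw [← h k hXk, hX.2 k hk]
      · exact ⟨X, hX, h, rfl⟩
    · rintro ⟨X, hX, h, rfl⟩
      exact ⟨⟨X, hX, rfl⟩, fun h => hYA (Sum.inl_injective h ▸ hX), Or.inr h⟩
  have hF : ∀ x, x ∈ Finset.univ.filter (· ∈ (Sum.inl '' (S \ A) : Set ((V → SignType) ⊕ V))) →
      ∃ Y ∈ S, Y ∉ A ∧ Sum.inl Y = x := by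
    intro x hx
    obtain ⟨Y, hY, rfl⟩ := (Finset.mem_filter.1 hx).2
    exact ⟨Y, hY.1, hY.2, rfl⟩
  have := acyclicBelow_cliqueCpx_union signRel_refl signRel_symm (I := fun _ => True)
    (fun _ _ _ h => h) (Finset.univ.filter (· ∈ (Sum.inl '' (S \ A) : Set ((V → SignType) ⊕ V))))
    (fun _ _ _ h => h) (U := U) (n := n) ?_ (hA T subset_rfl Y₀ hY₀ _) ?_ ?_
  · convert this using 2
    rw [Finset.coe_filter]
    simp only [Finset.mem_univ, true_and]
    rw [show {x | x ∈ (Sum.inl '' (S \ A) : Set ((V → SignType) ⊕ V))} = Sum.inl '' (S \ A) from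
      rfl, ← Set.image_union, Set.sdiff_union_of_subset hAS]
  · intro x hx
    obtain ⟨Y, hY, hYA, rfl⟩ := hF x hx
    rintro ⟨Z, hZ, h⟩
    exact hYA (Sum.inl_injective h ▸ hZ)
  · intro x hx
    obtain ⟨Y, hY, hYA, rfl⟩ := hF x hx
    convert hA (T ∪ {k | Y k ≠ 0}) Set.subset_union_left (signComp Y Y₀)
      (hL.comp_mem Y (h₁ Y hY).1 Y₀ hY₀) n using 2
    ext Z
    rw [hnb Y hY hYA]
    constructor
    · rintro ⟨X, hX, h, rfl⟩
      refine ⟨X, ⟨hX.1, fun k hk => ?_⟩, rfl⟩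
      by_cases hYk : Y k = 0
      · rw [signComp, if_pos hYk]
        exact hX.2 k (hk.resolve_right fun h => h hYk)
      · rw [signComp, if_neg hYk, h k hYk]
    · rintro ⟨X, hX, rfl⟩
      refine ⟨X, ⟨hX.1, fun k hk => ?_⟩, fun k hk => ?_, rfl⟩
      · rw [hX.2 k (Or.inl hk), signComp]
        split_ifs with h
        exacts [rfl, (h₁ Y hY).2 k hk h]
      · rw [hX.2 k (Or.inr hk), signComp, if_neg hk]
  · intro x hx y hy hxy
    obtain ⟨Y, hY, hYA, rfl⟩ := hF x hx
    obtain ⟨Z, hZ, hZA, rfl⟩ := hF y hy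
    rcases hxy with h | h
    · right
      intro w
      rw [hnb Y hY hYA, hnb Z hZ hZA]
      rintro ⟨X, hX, h', rfl⟩
      exact ⟨X, hX, h.trans h', rfl⟩
    · left
      intro w
      rw [hnb Y hY hYA, hnb Z hZ hZA]
      rintro ⟨X, hX, h', rfl⟩
      exact ⟨X, hX, h.trans h', rfl⟩

theorem acyclicBelow_orderCpx_agreeing {L : Set (V → SignType)} (hL : IsCovectorSet L)
    (T : Set V) {Y₀ : V → SignType} (hY₀ : Y₀ ∈ L) (n : ℕ) :
    AcyclicBelow (orderCpx (agreeing L T Y₀)) n := by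
  classical
  induction hm : Tᶜ.ncard using Nat.strong_induction_on generalizing T Y₀ n with | _ m ih
  by_cases hT : ∃ v, v ∉ T
  · obtain ⟨v, hv⟩ := hT
    have hA : ∀ T', insert v T ⊆ T' → ∀ Y ∈ L, ∀ n,
        AcyclicBelow (orderCpx (agreeing L T' Y)) n := by
      intro T' hT' Y hY n
      refine ih _ ?_ T' hY n rfl
      rw [← hm]
      refine Set.ncard_lt_ncard (Set.ssubset_iff_subset_ne.2 ⟨Set.compl_subset_compl.2
        ((Set.subset_insert v T).trans hT'), fun h => ?_⟩)
      rw [compl_inj_iff] at h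
      exact hv (h ▸ hT' (Set.mem_insert v T))
    have half : ∀ Y ∈ agreeing L T Y₀, Y v ≠ 0 → ∀ n,
        AcyclicBelow (orderCpx {Z | Z ∈ agreeing L T Y₀ ∧ Z v ≠ -Y v}) n := by
      intro Y hY hYv n
      refine acyclicBelow_orderCpx_of_conforms hL (T := insert v T) hY.1 ?_ ?_ hA n
      · refine fun Z hZ => ⟨hZ.1.1, fun k hk hZk => ?_⟩
        rcases hk with rfl | hk
        · have := hZ.2
          revert this hYv hZk
          generalize Y k = a, Z k = b; decide +revert
        · rw [hZ.1.2 k hk, hY.2 k hk]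
      · refine fun Z hZ h => ⟨⟨hZ, fun k hk => ?_⟩, ?_⟩
        · rw [h k (Or.inr hk), hY.2 k hk]
        · rw [h v (Or.inl rfl)]
          revert hYv; generalize Y v = a; decide +revert
    have whole : ∀ Y ∈ agreeing L T Y₀, Y v ≠ 0 → (∀ Z ∈ agreeing L T Y₀, Z v ≠ -Y v) →
        AcyclicBelow (orderCpx (agreeing L T Y₀)) n := by
      intro Y hY hYv h
      convert half Y hY hYv n using 2
      ext Z
      exact ⟨fun hZ => ⟨hZ, h Z hZ⟩, fun hZ => hZ.1⟩
    by_cases hpos : ∃ Y ∈ agreeing L T Y₀, Y v = 1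
    · obtain ⟨Y, hY, hYv⟩ := hpos
      by_cases hneg : ∃ Z ∈ agreeing L T Y₀, Z v = -1
      · obtain ⟨Z, hZ, hZv⟩ := hneg
        obtain ⟨W, hW, hWv, hWT⟩ := hL.exists_eq_zero Y hY.1 Z hZ.1 T
          (fun k hk => by rw [hY.2 k hk, hZ.2 k hk]) v hYv hZv
        have hp := half Y hY (by rw [hYv]; decide) n
        have hn := half Z hZ (by rw [hZv]; decide) n
        rw [hYv] at hp
        rw [hZv, neg_neg] at hn
        refine acyclicBelow_union (fun t ht => mem_orderCpx_or v ht)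
          (orderCpx_mono fun Y hY => hY.1) (orderCpx_mono fun Y hY => hY.1)
          (mem_orderCpx_inter_iff (S₀ := agreeing L (insert v T) W) fun X => ?_)
          orderCpx_subset orderCpx_subset hp hn (hA _ subset_rfl W hW n)
        constructor
        · intro hX
          have hXv := hX.2 v (Or.inl rfl)
          rw [hWv] at hXv
          have hX' : X ∈ agreeing L T Y₀ := ⟨hX.1, fun k hk => by
            rw [hX.2 k (Or.inr hk), hWT k hk, hY.2 k hk]⟩
          exact ⟨⟨hX', by rw [hXv]; decide⟩, ⟨hX', by rw [hXv]; decide⟩⟩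
        · rintro ⟨⟨hX, hX₁⟩, ⟨-, hX₂⟩⟩
          refine ⟨hX.1, fun k hk => ?_⟩
          rcases hk with rfl | hk
          · rw [hWv]
            revert hX₁ hX₂; generalize X k = a; decide +revert
          · rw [hX.2 k hk, hWT k hk, hY.2 k hk]
      · push Not at hneg
        exact whole Y hY (by rw [hYv]; decide) (by rwa [hYv])
    · push Not at hpos
      by_cases hneg : ∃ Z ∈ agreeing L T Y₀, Z v = -1
      · obtain ⟨Z, hZ, hZv⟩ := hneg
        exact whole Z hZ (by rw [hZv]; decide) (by rwa [hZv, neg_neg])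
      · push Not at hneg
        convert hA _ subset_rfl Y₀ hY₀ n using 2
        have h0 : ∀ X ∈ agreeing L T Y₀, X v = 0 := fun X hX => by
          have h₁ := hpos X hX
          have h₂ := hneg X hX
          revert h₁ h₂; generalize X v = a; decide +revert
        ext X
        refine ⟨fun hX => ⟨hX.1, fun k hk => ?_⟩, fun hX => ⟨hX.1, fun k hk => hX.2 k (Or.inr hk)⟩⟩
        rcases hk with rfl | hk
        · rw [h0 X hX, h0 Y₀ ⟨hY₀, fun _ _ => rfl⟩]
        · exact hX.2 k hk
  · push Not at hT
    refine acyclicBelow_of_cone (Sum.inl Y₀) (fun t ht => ?_) n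
    have h : ∀ x ∈ insert (Sum.inl Y₀) t, x = Sum.inl Y₀ := by
      intro x hx
      rcases Finset.mem_insert.1 hx with hx | hx
      · exact hx
      · obtain ⟨Y, hY, rfl⟩ := ht.1 x hx
        exact congrArg Sum.inl (funext fun k => hY.2 k (hT k))
    refine ⟨fun x hx => ⟨Y₀, ⟨hY₀, fun _ _ => rfl⟩, (h x hx).symm⟩, fun x hx y hy => ?_, trivial⟩
    rw [h x hx, h y hy]
    exact signRel_refl _

end Covectors

section Sphere

variable {V : Type*} [Fintype V] [DecidableEq V]

/-- When the members of `L` are determined up to order by a set `B` on which all sign patterns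
occur, the nonzero members of `L` carry a nontrivial cycle with `B.card` vertices in each
simplex. -/
theorem exists_not_boundsIn_orderCpx {L : Set (V → SignType)} (hL : IsCovectorSet L) {B : Finset V}
    (hB : ∀ Y ∈ L, (∀ k ∈ B, Y k = 0) → Y = 0)
    (hB' : ∀ X : V → SignType, ∃ Y ∈ L, ∀ k ∈ B, Y k = X k) :
    ∃ c, IsChainIn (orderCpx {Y | Y ∈ L ∧ Y ≠ 0}) B.card c ∧ chainBdry c = 0 ∧
      ¬ BoundsIn (orderCpx {Y | Y ∈ L ∧ Y ≠ 0}) B.card c := by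
  classical
  have key : ∀ D ⊆ B, ∃ c, IsChainIn (orderCpx {Y | Y ∈ L ∧ Y ≠ 0 ∧ ∀ k ∈ B, k ∉ D → Y k = 0})
      D.card c ∧ chainBdry c = 0 ∧
      ¬ BoundsIn (orderCpx {Y | Y ∈ L ∧ Y ≠ 0 ∧ ∀ k ∈ B, k ∉ D → Y k = 0}) D.card c := by
    intro D
    induction D using Finset.induction_on with
    | empty =>
      intro _
      refine ⟨fun t => if t = ∅ then 1 else 0, fun t ht => ?_, ?_, ?_⟩
      · have : t = ∅ := by by_contra h; simp [h] at ht
        subst this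
        simp [mem_orderCpx_iff]
      · ext t; simp [chainBdry]
      · rintro ⟨d, hd, hdc⟩
        have hd0 : d = 0 := by
          ext t
          by_contra h
          obtain ⟨ht, htc⟩ := hd t h
          obtain ⟨x, hx⟩ := Finset.card_pos.1 (htc ▸ Nat.succ_pos _ : 0 < t.card)
          obtain ⟨Y, hY, -⟩ := ht.1 x hx
          exact hY.2.1 (hB Y hY.1 fun k hk => hY.2.2 k hk (Finset.notMem_empty k))
        rw [hd0, chainBdry_zero] at hdc
        simpa using congrFun hdc ∅
    | insert b D hbD ih =>
      intro hD
      have hbB := hD (Finset.mem_insert_self b D)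
      rw [Finset.card_insert_of_notMem hbD]
      have half : ∀ e : SignType, e ≠ 0 → ∀ n, AcyclicBelow (orderCpx {Y | Y ∈ {Y | Y ∈ L ∧ Y ≠ 0 ∧
          ∀ k ∈ B, k ∉ insert b D → Y k = 0} ∧ Y b ≠ -e}) n := by
        intro e he n
        obtain ⟨Y₀, hY₀, h⟩ := hB' (Function.update 0 b e)
        refine acyclicBelow_orderCpx_of_conforms hL (T := {k | k ∈ B ∧ k ∉ D}) hY₀ ?_ ?_
          (fun T' _ Y hY n => acyclicBelow_orderCpx_agreeing hL T' hY n) n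
        · rintro Y ⟨⟨hY, -, hYB⟩, hYb⟩
          refine ⟨hY, fun k hk hYk => ?_⟩
          rw [h k hk.1]
          by_cases hkb : k = b
          · subst hkb
            rw [Function.update_self]
            have key : ∀ a e : SignType, e ≠ 0 → a ≠ 0 → a ≠ -e → a = e := by decide
            exact key _ _ he hYk hYb
          · refine absurd (hYB k hk.1 fun h' => ?_) hYk
            rcases Finset.mem_insert.1 h' with h' | h'
            exacts [hkb h', hk.2 h']
        · intro Y hY hYT
          have hYb : Y b = e := by rw [hYT b ⟨hbB, hbD⟩, h b hbB, Function.update_self]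
          refine ⟨⟨hY, fun h0 => he (by rw [← hYb, h0, Pi.zero_apply]), fun k hk hkD => ?_⟩, ?_⟩
          · rw [Finset.mem_insert, not_or] at hkD
            rw [hYT k ⟨hk, hkD.2⟩, h k hk, Function.update_of_ne hkD.1, Pi.zero_apply]
          · have key : ∀ e : SignType, e ≠ 0 → e ≠ -e := by decide
            exact hYb ▸ key e he
      refine exists_not_boundsIn_union (fun t ht => mem_orderCpx_or b ht)
        (orderCpx_mono fun Y hY => hY.1) (orderCpx_mono fun Y hY => hY.1)
        (mem_orderCpx_inter_iff (S₀ := {Y | Y ∈ L ∧ Y ≠ 0 ∧ ∀ k ∈ B, k ∉ D → Y k = 0}) fun Y => ?_)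
        orderCpx_subset orderCpx_subset (half 1 (by decide)) (half (-1) (by decide))
        (ih ((Finset.subset_insert b D).trans hD))
      constructor
      · rintro ⟨hY, hY0, h⟩
        have hYb := h b hbB hbD
        have h' : ∀ k ∈ B, k ∉ insert b D → Y k = 0 := fun k hk hkD =>
          h k hk fun h => hkD (Finset.mem_insert_of_mem h)
        exact ⟨⟨⟨hY, hY0, h'⟩, by rw [hYb]; decide⟩, ⟨⟨hY, hY0, h'⟩, by rw [hYb]; decide⟩⟩
      · rintro ⟨⟨⟨hY, hY0, h⟩, h₁⟩, ⟨-, h₂⟩⟩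
        refine ⟨hY, hY0, fun k hk hkD => ?_⟩
        by_cases hkb : k = b
        · subst hkb
          revert h₁ h₂; generalize Y k = a; decide +revert
        · exact h k hk fun h => (Finset.mem_insert.1 h).elim hkb hkD
  have hset : {Y | Y ∈ L ∧ Y ≠ 0 ∧ ∀ k ∈ B, k ∉ B → Y k = 0} = {Y | Y ∈ L ∧ Y ≠ 0} := by
    ext Y
    exact ⟨fun h => ⟨h.1, h.2.1⟩, fun h => ⟨h.1, h.2, fun k hk hk' => absurd hk hk'⟩⟩
  simpa only [hset] using key B subset_rfl

end Sphere

section Mixed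

variable {V : Type*}

/-- The complex of sets consisting of a chain in `S` and a subset of `T` in the family `J`, such
that all sign vectors of the former are nonpositive on the latter. -/
abbrev mixedCpx (J : Finset V → Prop) (S : Set (V → SignType)) (T : Set V) :
    Set (Finset ((V → SignType) ⊕ V)) :=
  cliqueCpx SignRel (fun t => J t.toRight) (Sum.inl '' S ∪ Sum.inr '' T)

theorem neighbors_inr (S : Set (V → SignType)) (T : Set V) (v : V) :
    neighbors SignRel (Sum.inl '' S ∪ Sum.inr '' T) (Sum.inr v) =
      Sum.inl '' {Y | Y ∈ S ∧ Y v ≠ 1} ∪ Sum.inr '' (T \ {v}) := by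
  ext (Y | w) <;> simp [neighbors, SignRel]

theorem family_toRight_mono {J : Finset V → Prop} (hJ : ∀ s t, s ⊆ t → J t → J s) :
    ∀ s t : Finset ((V → SignType) ⊕ V), s ⊆ t → J t.toRight → J s.toRight :=
  fun _ _ hst => hJ _ _ (Finset.toRight_monotone hst)

theorem mixedCpx_empty_right {J : Finset V → Prop} (hJ : J ∅) (S : Set (V → SignType)) :
    mixedCpx J S ∅ = orderCpx S := by
  ext t
  simp only [cliqueCpx, Set.image_empty, Set.union_empty, Set.mem_ofPred_eq, and_true]
  refine ⟨fun h => ⟨h.1, h.2.1⟩, fun h => ⟨h.1, h.2, ?_⟩⟩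
  convert hJ
  refine Finset.eq_empty_of_forall_notMem fun v hv => ?_
  obtain ⟨Y, -, hY⟩ := h.1 _ (Finset.mem_toRight.1 hv)
  cases hY

theorem sdiff_mixed (S : Set (V → SignType)) (T : Set V) (v : V) :
    (Sum.inl '' S ∪ Sum.inr '' T) \ {Sum.inr v} =
      (Sum.inl '' S ∪ Sum.inr '' (T \ {v}) : Set ((V → SignType) ⊕ V)) := by
  ext (Y | w) <;> simp

variable [Fintype V] [DecidableEq V]

theorem link_mixedCpx (J : Finset V → Prop) (S : Set (V → SignType)) (T : Set V) (v : V) :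
    cliqueCpx SignRel (fun s => Sum.inr v ∉ s ∧ J (insert (Sum.inr v) s).toRight)
        (neighbors SignRel (Sum.inl '' S ∪ Sum.inr '' T) (Sum.inr v)) =
      mixedCpx (fun s => v ∉ s ∧ J (insert v s)) {Y | Y ∈ S ∧ Y v ≠ 1} (T \ {v}) := by
  rw [neighbors_inr]
  simp [mixedCpx]

theorem acyclicBelow_mixedCpx_of_link {J : Finset V → Prop} (hJ : ∀ s t, s ⊆ t → J t → J s)
    {S : Set (V → SignType)} {T : Set V} {v : V} (hv : v ∈ T) {n : ℕ}
    (hD : AcyclicBelow (mixedCpx J S (T \ {v})) (n + 1))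
    (hL : AcyclicBelow (mixedCpx (fun s => v ∉ s ∧ J (insert v s)) {Y | Y ∈ S ∧ Y v ≠ 1}
      (T \ {v})) n) :
    AcyclicBelow (mixedCpx J S T) (n + 1) := by
  refine acyclicBelow_cliqueCpx_of_link signRel_refl signRel_symm (family_toRight_mono hJ)
    (x := Sum.inr v) (Or.inr ⟨v, hv, rfl⟩) ?_ ?_
  · rwa [sdiff_mixed]
  · rwa [link_mixedCpx]

theorem acyclicBelow_mixedCpx {J : Finset V → Prop} (hJ : ∀ s t, s ⊆ t → J t → J s)
    {S : Set (V → SignType)} {T : Finset V} (h : ∀ s ⊆ T, J s → ∀ n,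
      AcyclicBelow (orderCpx {Y | Y ∈ S ∧ ∀ v ∈ s, Y v ≠ 1}) n) (n : ℕ) :
    AcyclicBelow (mixedCpx J S T) n := by
  induction T using Finset.induction_on generalizing J S n with
  | empty =>
    rw [Finset.coe_empty]
    by_cases hJ0 : J ∅
    · rw [mixedCpx_empty_right hJ0]
      simpa using h ∅ subset_rfl hJ0 n
    · exact acyclicBelow_of_isEmpty
        (fun t ht => hJ0 (hJ _ _ (Finset.empty_subset _) ht.2.2)) n
  | insert v T hv ih =>
    rcases n with _ | n
    · exact fun m hm => absurd hm (Nat.not_lt_zero m)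
    have hT : (↑(insert v T) \ {v} : Set V) = T := by
      rw [Finset.coe_insert, Set.insert_sdiff_self_of_notMem (by simpa using hv)]
    refine acyclicBelow_mixedCpx_of_link hJ (v := v) (by simp) ?_ ?_
    · rw [hT]
      exact ih hJ (fun s hs => h s (hs.trans (Finset.subset_insert v T))) _
    · rw [hT]
      refine ih (fun s t hst ht => ⟨fun h => ht.1 (hst h),
        hJ _ _ (Finset.insert_subset_insert v hst) ht.2⟩) (fun s hs hJs n => ?_) _
      convert h (insert v s) (Finset.insert_subset_insert v hs) hJs.2 n using 3
      simp [and_assoc]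

/-- Adjoining elements of the ground set does not create new boundaries between chains of sign
vectors when the links of sets of such elements are acyclic. -/
theorem BoundsIn.of_mixedCpx {J : Finset V → Prop} (hJ : ∀ s t, s ⊆ t → J t → J s) (hJ0 : J ∅)
    {S : Set (V → SignType)} {T : Finset V} (h : ∀ s ⊆ T, s.Nonempty → J s → ∀ n,
      AcyclicBelow (orderCpx {Y | Y ∈ S ∧ ∀ v ∈ s, Y v ≠ 1}) n) {m : ℕ}
    {c : Finset ((V → SignType) ⊕ V) → ZMod 2} (hc : IsChainIn (orderCpx S) m c)
    (hb : BoundsIn (mixedCpx J S T) m c) : BoundsIn (orderCpx S) m c := by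
  induction T using Finset.induction_on with
  | empty => rwa [Finset.coe_empty, mixedCpx_empty_right hJ0] at hb
  | insert v T hv ih =>
    have hT : (↑(insert v T) \ {v} : Set V) = T := by
      rw [Finset.coe_insert, Set.insert_sdiff_self_of_notMem (by simpa using hv)]
    refine ih (fun s hs => h s (hs.trans (Finset.subset_insert v T))) ?_
    refine BoundsIn.of_link (K := mixedCpx J S ↑(insert v T)) (Sum.inr v)
      (L := mixedCpx (fun s => v ∉ s ∧ J (insert v s)) {Y | Y ∈ S ∧ Y v ≠ 1} T)
      (fun t ht hvt => ?_) (fun t hvt ht => ?_) (fun t ht => ?_) ?_ (fun t ht => ?_) hb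
    · have := mem_cliqueCpx_sdiff ht hvt
      rwa [sdiff_mixed, hT] at this
    · have := mem_cliqueCpx_of_insert (family_toRight_mono hJ) hvt ht
      rwa [link_mixedCpx, hT] at this
    · have := mem_cliqueCpx_of_link (R := SignRel) (W := Sum.inl '' S ∪ Sum.inr '' ↑(insert v T))
        (x := Sum.inr v) (family_toRight_mono hJ) (t := t) (by rwa [link_mixedCpx, hT])
      rwa [sdiff_mixed, hT] at this
    · refine acyclicBelow_mixedCpx (fun s t hst ht => ⟨fun h => ht.1 (hst h),
        hJ _ _ (Finset.insert_subset_insert v hst) ht.2⟩) (fun s hs hJs n => ?_)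
      convert h (insert v s) (Finset.insert_subset_insert v hs) (Finset.insert_nonempty v s)
        hJs.2 n using 3
      simp [and_assoc]
    · by_contra h0
      obtain ⟨Y, -, hY⟩ := (hc t h0).1.1 _ ht
      cases hY

end Mixed

namespace FinMatroid

variable {V : Type*} [DecidableEq V]

/-- The contraction of a matroid by a non-loop. -/
def contractElem (N : FinMatroid V) (v : V) (hv : N.Indep {v}) : FinMatroid V where
  Indep s := v ∉ s ∧ N.Indep (insert v s)
  empty_indep := ⟨Finset.notMem_empty v, hv⟩
  indep_subset _ _ hs hts :=
    ⟨fun h => hs.1 (hts h), N.indep_subset hs.2 (Finset.insert_subset_insert v hts)⟩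
  indep_exchange s t hs ht hst := by
    obtain ⟨x, hx, hxs, h⟩ := N.indep_exchange hs.2 ht.2 (by
      rwa [Finset.card_insert_of_notMem hs.1, Finset.card_insert_of_notMem ht.1,
        Nat.add_lt_add_iff_right])
    rw [Finset.mem_insert, not_or] at hxs
    refine ⟨x, (Finset.mem_insert.1 hx).resolve_left hxs.1, hxs.2, fun h' => ?_, ?_⟩
    · rcases Finset.mem_insert.1 h' with h' | h'
      exacts [hxs.1 h'.symm, hs.1 h']
    · rwa [Finset.insert_comm]

theorem indep_insert_of_coloop (N : FinMatroid V) {U I : Finset V} {v : V} (hI : N.Indep I)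
    (hIU : I ⊆ U) (h : ∀ s ⊆ U.erase v, N.Indep s → s.card < I.card) {s : Finset V}
    (hs : N.Indep s) (hsU : s ⊆ U.erase v) : N.Indep (insert v s) := by
  induction hk : I.card - s.card using Nat.strong_induction_on generalizing s with | _ k ih
  have hlt := h s hsU hs
  obtain ⟨x, hx, hxs, hxi⟩ := N.indep_exchange hs hI hlt
  by_cases hxv : x = v
  · rwa [← hxv]
  · refine N.indep_subset (ih _ ?_ hxi (Finset.insert_subset
      (Finset.mem_erase.2 ⟨hxv, hIU hx⟩) hsU) rfl)
      (Finset.insert_subset_insert v (Finset.subset_insert x s))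
    rw [Finset.card_insert_of_notMem hxs]
    omega

variable [Fintype V]

theorem acyclicBelow_mixedCpx_empty (N : FinMatroid V) {U I : Finset V} (hI : N.Indep I)
    (hIU : I ⊆ U) : AcyclicBelow (mixedCpx N.Indep ∅ U) I.card := by
  induction U using Finset.strongInduction generalizing N I with | _ U ih
  rcases I.eq_empty_or_nonempty with rfl | ⟨v, hv⟩
  · exact fun m hm => absurd hm (Nat.not_lt_zero m)
  have hvU := hIU hv
  by_cases h : ∃ I' ⊆ U.erase v, N.Indep I' ∧ I'.card = I.card
  · obtain ⟨I', hI'U, hI', hcard⟩ := h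
    have hv' : N.Indep {v} := N.indep_subset hI (by simpa using hv)
    have hc : I.card = (I.erase v).card + 1 := (Finset.card_erase_add_one hv).symm
    have hD := ih _ (Finset.erase_ssubset hvU) N hI' hI'U
    have hL := ih _ (Finset.erase_ssubset hvU) (N.contractElem v hv') (I := I.erase v)
      ⟨Finset.notMem_erase v I, by rwa [Finset.insert_erase hv]⟩ (Finset.erase_subset_erase v hIU)
    rw [hcard, hc, Finset.coe_erase] at hD
    rw [Finset.coe_erase] at hL
    rw [hc]
    refine acyclicBelow_mixedCpx_of_link (fun s t hst ht => N.indep_subset ht hst) hvU hD ?_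
    convert hL using 2
    · rfl
    · exact Set.sep_empty _
  · refine acyclicBelow_of_cone (Sum.inr v) (fun t ht => ?_) _
    refine ⟨fun x hx => ?_, fun x hx y hy => ?_, ?_⟩
    · rcases Finset.mem_insert.1 hx with rfl | hx
      exacts [Or.inr ⟨v, hvU, rfl⟩, ht.1 x hx]
    · have : ∀ x ∈ insert (Sum.inr v) t, ∃ w, x = Sum.inr w := by
        intro x hx
        rcases Finset.mem_insert.1 hx with rfl | hx
        · exact ⟨v, rfl⟩
        · obtain ⟨w, -, hw⟩ := (ht.1 x hx).resolve_left (by simp)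
          exact ⟨w, hw.symm⟩
      obtain ⟨a, rfl⟩ := this x hx
      obtain ⟨b, rfl⟩ := this y hy
      trivial
    · beta_reduce
      rw [Finset.toRight_insert_inr]
      have htU : t.toRight ⊆ U := by
        intro w hw
        obtain ⟨w', hw', h⟩ := (ht.1 _ (Finset.mem_toRight.1 hw)).resolve_left (by simp)
        cases h
        exact hw'
      by_cases hvt : v ∈ t.toRight
      · rw [Finset.insert_eq_of_mem hvt]; exact ht.2.2
      · refine N.indep_insert_of_coloop hI hIU (fun s hs hsi => ?_) ht.2.2
          fun w hw => Finset.mem_erase.2 ⟨?_, htU hw⟩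
        · by_contra! hle
          obtain ⟨s', hs', hcard⟩ := Finset.exists_subset_card_eq hle
          exact h ⟨s', hs'.trans hs, N.indep_subset hsi hs', hcard⟩
        · rintro rfl; exact hvt hw

theorem acyclicBelow_mixedCpx_univ (N : FinMatroid V) (S : Set (V → SignType)) {r : ℕ}
    (hr : ∃ I, N.Indep I ∧ I.card = r + 1)
    (hS : ∀ Y ∈ S, ∃ I, N.Indep I ∧ I.card = r ∧ ∀ v ∈ I, Y v ≠ 1) :
    AcyclicBelow (mixedCpx N.Indep S Set.univ) (r + 1) := by
  classical
  have hF : ∀ x, x ∈ Finset.univ.filter (· ∈ (Sum.inl '' S : Set ((V → SignType) ⊕ V))) →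
      ∃ Y ∈ S, Sum.inl Y = x := fun x hx => (Finset.mem_filter.1 hx).2
  have hnb : ∀ Y : V → SignType, neighbors SignRel (Sum.inr '' Set.univ) (Sum.inl Y) =
      Sum.inl '' ∅ ∪ Sum.inr '' ((Finset.univ.filter fun v => Y v ≠ 1 : Finset V) : Set V) := by
    intro Y; ext (Z | w) <;> simp [neighbors, SignRel]
  have := acyclicBelow_cliqueCpx_union signRel_refl signRel_symm (I := fun t => N.Indep t.toRight)
    (family_toRight_mono fun s t hst ht => N.indep_subset ht hst)
    (Finset.univ.filter (· ∈ (Sum.inl '' S : Set ((V → SignType) ⊕ V))))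
    (U := Sum.inr '' Set.univ) (n := r) ?_ ?_ ?_ ?_ ?_
  · convert this using 2
    rw [Finset.coe_filter]
    simp only [Finset.mem_univ, true_and]
    rfl
  · intro x hx s hs
    obtain ⟨Y, -, rfl⟩ := hF x hx
    simpa using hs
  · intro x hx
    obtain ⟨Y, -, rfl⟩ := hF x hx
    simp
  · obtain ⟨I, hI, hIr⟩ := hr
    have := N.acyclicBelow_mixedCpx_empty hI (Finset.subset_univ I)
    rwa [hIr, Finset.coe_univ, mixedCpx, Set.image_empty, Set.empty_union] at this
  · intro x hx
    obtain ⟨Y, hY, rfl⟩ := hF x hx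
    obtain ⟨I, hI, hIr, h⟩ := hS Y hY
    rw [hnb, ← hIr]
    exact N.acyclicBelow_mixedCpx_empty hI fun v hv => by simpa using h v hv
  · intro x hx y hy hxy
    obtain ⟨Y, hY, rfl⟩ := hF x hx
    obtain ⟨Z, hZ, rfl⟩ := hF y hy
    have key : ∀ {Y Z : V → SignType}, Conforms Y Z →
        neighbors SignRel (Sum.inr '' Set.univ) (Sum.inl Z) ⊆
          neighbors SignRel (Sum.inr '' Set.univ) (Sum.inl Y) := by
      rintro Y Z h w ⟨⟨v, -, rfl⟩, -, hw⟩
      refine ⟨⟨v, trivial, rfl⟩, by simp, fun hYv => hw ?_⟩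
      rw [← h v (by rw [hYv]; decide), hYv]
    exact hxy.elim (fun h => Or.inr (key h)) (fun h => Or.inl (key h))

theorem exists_indep_of_le_rk (N : FinMatroid V) {S : Finset V} {n : ℕ}
    (hn : n ≤ N.rk S) : ∃ I ⊆ S, N.Indep I ∧ I.card = n := by
  obtain ⟨I, hIS, hI, hIc⟩ := Nat.sSup_mem
      (s := {n | ∃ I : Finset V, I ⊆ S ∧ N.Indep I ∧ I.card = n})
    ⟨0, ∅, Finset.empty_subset S, N.empty_indep, Finset.card_empty⟩
    ⟨Fintype.card V, by rintro _ ⟨I, -, -, rfl⟩; exact Finset.card_le_univ I⟩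
  obtain ⟨I', hI', hc⟩ := Finset.exists_subset_card_eq (hn.trans_eq hIc.symm)
  exact ⟨I', hI'.trans hIS, N.indep_subset hI hI', hc⟩

end FinMatroid

namespace SignedSet

variable {V : Type*} [DecidableEq V]

/-- The sign vector of a signed set. -/
def sign (C : SignedSet V) : V → SignType :=
  fun k => if k ∈ C.pos then 1 else if k ∈ C.neg then -1 else 0

theorem sign_eq_one_iff {C : SignedSet V} {k : V} : C.sign k = 1 ↔ k ∈ C.pos := by
  unfold sign
  split_ifs <;> simp_all

theorem sign_eq_neg_one_iff {C : SignedSet V} {k : V} : C.sign k = -1 ↔ k ∈ C.neg := by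
  have := fun h : k ∈ C.pos => Finset.disjoint_left.1 C.disj h
  unfold sign
  split_ifs <;> simp_all

theorem sign_ne_zero_iff {C : SignedSet V} {k : V} : C.sign k ≠ 0 ↔ k ∈ C.support := by
  rw [support, Finset.mem_union, ← sign_eq_one_iff, ← sign_eq_neg_one_iff]
  generalize C.sign k = a
  decide +revert

theorem sign_negate (C : SignedSet V) : C.negate.sign = -C.sign := by
  ext k
  have h₁ : C.negate.sign k = 1 ↔ C.sign k = -1 := by
    rw [sign_eq_one_iff, sign_eq_neg_one_iff]; rfl
  have h₂ : C.negate.sign k = -1 ↔ C.sign k = 1 := by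
    rw [sign_eq_one_iff, sign_eq_neg_one_iff]; rfl
  rw [Pi.neg_apply]
  revert h₁ h₂
  generalize C.negate.sign k = a, C.sign k = b
  decide +revert

end SignedSet

namespace OrientedMatroid

variable {V : Type*} [DecidableEq V] (M : OrientedMatroid V)

/-- The circuits of an oriented matroid as sign vectors. -/
def signVectors : Set (V → SignType) := SignedSet.sign '' M.Circuits

theorem isSignedCircuits_signVectors : IsSignedCircuits M.signVectors where
  neg_mem := by
    rintro _ ⟨C, hC, rfl⟩
    exact ⟨C.negate, M.negate_mem C hC, C.sign_negate⟩
  eq_or_eq_neg := by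
    rintro _ ⟨C, hC, rfl⟩ _ ⟨D, hD, rfl⟩ h
    rcases M.incomparable C hC D hD fun k hk =>
      SignedSet.sign_ne_zero_iff.1 (h k (SignedSet.sign_ne_zero_iff.2 hk)) with rfl | rfl
    exacts [Or.inl rfl, Or.inr D.sign_negate]
  elim := by
    have key : ∀ C ∈ M.Circuits, ∀ D ∈ M.Circuits, C.sign ≠ -D.sign → ∀ e, C.sign e = 1 →
        D.sign e = -1 → ∃ Z ∈ M.signVectors, Z e = 0 ∧
          ∀ k, Z k ≠ 0 → Z k = C.sign k ∨ Z k = D.sign k := by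
      intro C hC D hD hCD e hCe hDe
      obtain ⟨Z, hZ, hp, hn⟩ := M.elimination C hC D hD
        (by rintro rfl; exact hCD D.sign_negate) e
        (Finset.mem_inter.2 ⟨SignedSet.sign_eq_one_iff.1 hCe, SignedSet.sign_eq_neg_one_iff.1 hDe⟩)
      refine ⟨Z.sign, ⟨Z, hZ, rfl⟩, ?_, fun k hk => ?_⟩
      · by_contra h
        rcases Finset.mem_union.1 (SignedSet.sign_ne_zero_iff.1 h) with h | h
        exacts [Finset.notMem_erase e _ (hp h), Finset.notMem_erase e _ (hn h)]
      · rcases Finset.mem_union.1 (SignedSet.sign_ne_zero_iff.1 hk) with h | h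
        · rw [SignedSet.sign_eq_one_iff.2 h]
          exact (Finset.mem_union.1 (Finset.mem_of_mem_erase (hp h))).imp
            (fun h => (SignedSet.sign_eq_one_iff.2 h).symm)
            (fun h => (SignedSet.sign_eq_one_iff.2 h).symm)
        · rw [SignedSet.sign_eq_neg_one_iff.2 h]
          exact (Finset.mem_union.1 (Finset.mem_of_mem_erase (hn h))).imp
            (fun h => (SignedSet.sign_eq_neg_one_iff.2 h).symm)
            (fun h => (SignedSet.sign_eq_neg_one_iff.2 h).symm)
    rintro _ ⟨C, hC, rfl⟩ _ ⟨D, hD, rfl⟩ hCD e hCe hDe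
    rcases SignType.trichotomy (C.sign e) with h | h | h
    · obtain ⟨Z, hZ, hZe, hZk⟩ := key D hD C hC (fun h' => hCD (by rw [h', neg_neg])) e
        (by rw [hDe, h]; decide) h
      exact ⟨Z, hZ, hZe, fun k hk => (hZk k hk).symm⟩
    · exact absurd h hCe
    · exact key C hC D hD hCD e h (by rw [hDe, h])

theorem isCovectorSet_covectors [Fintype V] : IsCovectorSet (covectors M.signVectors Set.univ) where
  comp_mem _ hY _ hZ := signComp_mem hY hZ
  exists_eq_zero _ hY _ hZ _ hYZ _ hYv hZv :=
    M.isSignedCircuits_signVectors.exists_eq_zero_of_opposite hY hZ hYZ hYv hZv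

theorem exists_indep_card_eq_rank [Fintype V] :
    ∃ B, M.Indep B ∧ B.card = M.rank ∧ ∀ S, M.Indep S → S.card ≤ M.rank := by
  have hbdd : BddAbove {n | ∃ S : Finset V, M.Indep S ∧ S.card = n} :=
    ⟨Fintype.card V, by rintro _ ⟨I, -, rfl⟩; exact Finset.card_le_univ I⟩
  obtain ⟨B, hB, hBc⟩ := Nat.sSup_mem (s := {n | ∃ S : Finset V, M.Indep S ∧ S.card = n})
    ⟨0, ∅, fun C hC h => (M.support_nonempty C hC).ne_empty (Finset.subset_empty.1 h),
      Finset.card_empty⟩ hbdd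
  exact ⟨B, hB, hBc, fun S hS => le_csSup hbdd ⟨S, hS, rfl⟩⟩

variable {M}

theorem eq_zero_of_eq_zero_on_basis {B : Finset V} (hB : M.Indep B)
    (hmax : ∀ S, M.Indep S → S.card ≤ B.card) {Y : V → SignType}
    (hY : Y ∈ covectors M.signVectors Set.univ) (hYB : ∀ k ∈ B, Y k = 0) : Y = 0 := by
  ext v
  by_contra hv
  rw [Pi.zero_apply] at hv
  have hvB : v ∉ B := fun h => hv (hYB v h)
  have hdep : ¬ M.Indep (insert v B) := fun h => by
    have := hmax _ h
    rw [Finset.card_insert_of_notMem hvB] at this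
    omega
  unfold Indep at hdep
  push Not at hdep
  obtain ⟨C, hC, hCB⟩ := hdep
  have hCv : C.sign v ≠ 0 := by
    rw [SignedSet.sign_ne_zero_iff]
    by_contra h
    exact hB C hC ((Finset.subset_insert_iff_of_notMem h).1 hCB)
  have key : ∀ X ∈ M.signVectors, (∀ k, X k ≠ 0 → k ∈ insert v B) → Y v * X v ≠ 1 := by
    intro X hX hXB h
    obtain ⟨j, hj⟩ := hY X hX (fun _ _ => trivial) v h
    rcases Finset.mem_insert.1 (hXB j fun h => by simp [h] at hj) with rfl | hjB
    · rw [h] at hj; exact absurd hj (by decide)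
    · simp [hYB j hjB] at hj
  have h₁ := key C.sign ⟨C, hC, rfl⟩ fun k hk => hCB (SignedSet.sign_ne_zero_iff.1 hk)
  have h₂ := key (-C.sign) (M.isSignedCircuits_signVectors.neg_mem _ ⟨C, hC, rfl⟩)
    fun k hk => hCB (SignedSet.sign_ne_zero_iff.1 (by simpa using hk))
  rw [Pi.neg_apply] at h₂
  revert h₁ h₂ hCv hv
  generalize Y v = a, C.sign v = b
  decide +revert

theorem not_posCircuit_of_mem_covectors {Y : V → SignType}
    (hY : Y ∈ covectors M.signVectors Set.univ) {T : Finset V} (hT : ∀ k ∈ T, Y k = 1) :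
    ¬ M.PosCircuit T := by
  rintro ⟨C, hC, hneg, rfl⟩
  have hpos : ∀ k, C.sign k ≠ 0 → k ∈ C.pos := fun k hk => by
    simpa [SignedSet.support, hneg] using SignedSet.sign_ne_zero_iff.1 hk
  obtain ⟨k, hk⟩ := M.support_nonempty C hC
  have hk' := hpos k (SignedSet.sign_ne_zero_iff.2 hk)
  obtain ⟨j, hj⟩ := hY C.sign ⟨C, hC, rfl⟩ (fun _ _ => trivial) k
    (by rw [hT k hk', SignedSet.sign_eq_one_iff.2 hk', one_mul])
  have hj' := hpos j fun h => by simp [h] at hj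
  rw [hT j hj', SignedSet.sign_eq_one_iff.2 hj'] at hj
  exact absurd hj (by decide)

/-- A set containing no positive circuit is contained in the negative part of a covector. -/
theorem exists_covector_eq_neg_one [Fintype V] {T : Finset V}
    (hT : ∀ S ⊆ T, ¬ M.PosCircuit S) :
    ∃ Y ∈ covectors M.signVectors Set.univ, ∀ k ∈ T, Y k = -1 := by
  refine M.isSignedCircuits_signVectors.exists_extend (S := T) (Y := fun _ => -1) ?_
  rintro _ ⟨C, hC, rfl⟩ hCT k hk
  by_contra! h
  have hpos : C.pos = ∅ := Finset.eq_empty_of_forall_notMem fun j hj =>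
    h j (by rw [SignedSet.sign_eq_one_iff.2 hj]; decide)
  refine hT C.neg (fun j hj => ?_) ⟨C.negate, M.negate_mem C hC, hpos, rfl⟩
  exact hCT j (by rw [SignedSet.sign_eq_neg_one_iff.2 hj]; decide)

end OrientedMatroid

/-- **Main theorem (matroid colorful Carathéodory).** Let `M` be a loopless oriented
matroid and `N` a matroid with rank function `ρ`, both on the same finite ground set
`V`, with `rank M < rank N`.  If every `A ⊆ V` with `ρ(V - A) < rank M` contains a
positive circuit of `M`, then some positive circuit of `M` is independent in `N`. -/
theorem matroid_colorful_caratheodory {V : Type*} [LinearOrder V] [Fintype V]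
    (M : OrientedMatroid V) (hM : M.Loopless) (N : FinMatroid V)
    (hrank : M.rank < N.rank)
    (hyp : ∀ A : Finset V, N.rk (Finset.univ \ A) < M.rank →
      ∃ T ⊆ A, M.PosCircuit T) :
    ∃ T : Finset V, M.PosCircuit T ∧ N.Indep T := by
  by_contra! hno
  have hL := M.isCovectorSet_covectors
  have hK := M.isSignedCircuits_signVectors
  set L := covectors M.signVectors Set.univ
  obtain ⟨B, hB, hBr, hmax⟩ := M.exists_indep_card_eq_rank
  obtain ⟨c, hc, hc0, hcb⟩ := exists_not_boundsIn_orderCpx hL (B := B)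
    (fun Y hY h => OrientedMatroid.eq_zero_of_eq_zero_on_basis hB (hBr ▸ hmax) hY h)
    (fun X => hK.exists_extend (S := B) (Y := X) (by
      rintro _ ⟨C, hC, rfl⟩ hCB
      exact absurd (fun k hk => hCB k (SignedSet.sign_ne_zero_iff.2 hk)) (hB C hC)))
  refine hcb (BoundsIn.of_mixedCpx (J := N.Indep) (T := Finset.univ)
    (fun s t hst ht => N.indep_subset ht hst) N.empty_indep ?_ hc ?_)
  · intro s _ hs hsN n
    obtain ⟨Y₀, hY₀, h⟩ := M.exists_covector_eq_neg_one fun S hS hSM =>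
      hno S hSM (N.indep_subset hsN hS)
    refine acyclicBelow_orderCpx_of_conforms hL (T := s) hY₀ ?_ ?_
      (fun T' _ Y hY n => acyclicBelow_orderCpx_agreeing hL T' hY n) n
    · rintro Y ⟨hY, hYs⟩
      refine ⟨hY.1, fun k hk hYk => ?_⟩
      rw [h k hk]
      exact ((SignType.trichotomy (Y k)).resolve_right fun h' => h'.elim hYk (hYs k hk))
    · intro Y hY hYs
      have hYs' : ∀ k ∈ s, Y k = -1 := fun k hk => (hYs k hk).trans (h k hk)
      refine ⟨⟨hY, ?_⟩, fun k hk => by rw [hYs' k hk]; decide⟩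
      rintro rfl
      obtain ⟨k, hk⟩ := hs
      exact absurd (hYs' k hk) (by rw [Pi.zero_apply]; decide)
  · rw [Finset.coe_univ]
    refine N.acyclicBelow_mixedCpx_univ _ (r := M.rank) ?_ ?_ _ (by omega) c (hc.mono ?_) hc0
    · obtain ⟨I, -, hI⟩ := N.exists_indep_of_le_rk hrank
      exact ⟨I, hI⟩
    · rintro Y ⟨hY, -⟩
      have hle : M.rank ≤ N.rk (Finset.univ \ Finset.univ.filter fun v => Y v = 1) := by
        by_contra! hlt
        obtain ⟨T, hT, hTM⟩ := hyp _ hlt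
        exact OrientedMatroid.not_posCircuit_of_mem_covectors hY
          (fun k hk => (Finset.mem_filter.1 (hT hk)).2) hTM
      obtain ⟨I, hIY, hI, hIr⟩ := N.exists_indep_of_le_rk hle
      exact ⟨I, hI, hIr, fun v hv => by simpa using hIY hv⟩
    · intro t ht
      refine (mixedCpx_empty_right (J := N.Indep) N.empty_indep _ ▸ ht :
        t ∈ mixedCpx N.Indep _ ∅).imp (fun h x hx => (h x hx).imp id ?_) id
      simp
end

section
/- Let M be a loopless oriented matroid with at least one positive circuit, X its support complex on ground set V, and r = rank(M). Then the Alexander dual X^⋆ satisfies H̃_i(X^⋆; ℚ) = 0 for all i ≤ |V| − r − 3, i.e., η(X^⋆) ≥ |V| − r − 1. -/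
namespace SimplicialCpx

section Support

variable {V : Type*}

/-- The coefficient function `f` is supported on the members of `F` of cardinality `n`. -/
def IsChainOn (F : Set (Finset V)) (n : ℕ) (f : Finset V → ℚ) : Prop :=
  ∀ s, f s ≠ 0 → s ∈ F ∧ s.card = n

lemma IsChainOn.add {F : Set (Finset V)} {n : ℕ} {f g : Finset V → ℚ}
    (hf : IsChainOn F n f) (hg : IsChainOn F n g) : IsChainOn F n (f + g) := by
  intro s hs
  by_cases h : f s = 0
  · exact hg s (by simpa [h] using hs)
  · exact hf s h

lemma IsChainOn.neg {F : Set (Finset V)} {n : ℕ} {f : Finset V → ℚ}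
    (hf : IsChainOn F n f) : IsChainOn F n (-f) :=
  fun s hs => hf s (by simpa using hs)

lemma IsChainOn.sub {F : Set (Finset V)} {n : ℕ} {f g : Finset V → ℚ}
    (hf : IsChainOn F n f) (hg : IsChainOn F n g) : IsChainOn F n (f - g) := by
  rw [sub_eq_add_neg]; exact hf.add hg.neg

lemma IsChainOn.mono {F G : Set (Finset V)} {n : ℕ} {f : Finset V → ℚ}
    (hf : IsChainOn F n f) (h : F ⊆ G) : IsChainOn G n f :=
  fun s hs => ⟨h (hf s hs).1, (hf s hs).2⟩

lemma isChainOn_zero (F : Set (Finset V)) (n : ℕ) : IsChainOn F n 0 :=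
  fun _ hs => absurd rfl hs

end Support

section FunctionChains

variable {V : Type*} [LinearOrder V]

/-- The incidence sign `(-1) ^ #{u ∈ t | u < v}`. -/
def incSign (v : V) (t : Finset V) : ℚ := (-1) ^ (t.filter (· < v)).card

lemma incSign_mul_self (v : V) (t : Finset V) : incSign v t * incSign v t = 1 := by
  simp [incSign, ← mul_pow]

lemma incSign_ne_zero (v : V) (t : Finset V) : incSign v t ≠ 0 := by
  simp [incSign]

lemma incSign_insert {u : V} {t : Finset V} (hu : u ∉ t) (v : V) :
    incSign v (insert u t) = (if u < v then -1 else 1) * incSign v t := by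
  unfold incSign
  rw [Finset.filter_insert]
  split_ifs with h
  · rw [Finset.card_insert_of_notMem (by simp [hu]), pow_succ]; ring
  · simp

lemma incSign_insert_self (v : V) (t : Finset V) : incSign v (insert v t) = incSign v t := by
  unfold incSign
  rw [Finset.filter_insert]
  simp

lemma incSign_mul_incSign_insert {u v : V} {t : Finset V} (hu : u ∉ t) (hv : v ∉ t)
    (huv : u ≠ v) :
    incSign v t * incSign u (insert v t) = -(incSign u t * incSign v (insert u t)) := by
  rw [incSign_insert hu, incSign_insert hv]
  rcases lt_or_gt_of_ne huv with h | h
  · simp [h, h.not_gt]; ring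
  · simp [h, h.not_gt]; ring

/-- The cone with apex `e` over a chain. -/
def coneChain (e : V) (x : Finset V → ℚ) (t : Finset V) : ℚ :=
  if e ∈ t then incSign e (t.erase e) * x (t.erase e) else 0

lemma IsChainOn.coneChain {F G : Set (Finset V)} {n : ℕ} {x : Finset V → ℚ} {e : V}
    (hx : IsChainOn F n x) (h : ∀ s ∈ F, insert e s ∈ G) :
    IsChainOn G (n + 1) (coneChain e x) := by
  intro s hs
  unfold SimplicialCpx.coneChain at hs
  split_ifs at hs with he
  · obtain ⟨h₁, h₂⟩ := hx _ (right_ne_zero_of_mul hs)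
    refine ⟨by simpa [Finset.insert_erase he] using h _ h₁, ?_⟩
    rw [← Finset.card_erase_add_one he, h₂]
  · exact absurd rfl hs

/-- The part of a chain supported on sets not containing `e`. -/
def deletionPart (e : V) (z : Finset V → ℚ) (t : Finset V) : ℚ := if e ∈ t then 0 else z t

/-- The chain `b` off `e` such that `coneChain e b` is the part of `z` supported on sets
containing `e`. -/
def linkPart (e : V) (z : Finset V → ℚ) (t : Finset V) : ℚ :=
  if e ∈ t then 0 else incSign e t * z (insert e t)

lemma deletionPart_add_coneChain_linkPart (e : V) (z : Finset V → ℚ) :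
    deletionPart e z + coneChain e (linkPart e z) = z := by
  ext t
  by_cases he : e ∈ t
  · simp [deletionPart, coneChain, linkPart, he, ← mul_assoc, incSign_mul_self]
  · simp [deletionPart, coneChain, he]

variable [Fintype V]

/-- The simplicial boundary on coefficient functions. -/
def boundary : (Finset V → ℚ) →ₗ[ℚ] (Finset V → ℚ) where
  toFun f t := ∑ v ∈ tᶜ, incSign v t * f (insert v t)
  map_add' f g := by ext t; simp [mul_add, Finset.sum_add_distrib]
  map_smul' c f := by
    ext t
    simp only [Pi.smul_apply, smul_eq_mul, Finset.mul_sum, RingHom.id_apply]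
    exact Finset.sum_congr rfl fun v _ => by ring

lemma boundary_apply (f : Finset V → ℚ) (t : Finset V) :
    boundary f t = ∑ v ∈ tᶜ, incSign v t * f (insert v t) := rfl

lemma exists_insert_of_boundary_ne_zero {f : Finset V → ℚ} {t : Finset V}
    (h : boundary f t ≠ 0) : ∃ v, v ∉ t ∧ f (insert v t) ≠ 0 := by
  obtain ⟨v, hv, hne⟩ := Finset.exists_ne_zero_of_sum_ne_zero h
  exact ⟨v, by simpa using hv, right_ne_zero_of_mul hne⟩

lemma IsChainOn.boundary {F : Set (Finset V)} (hF : IsLowerSet F) {n : ℕ} {f : Finset V → ℚ}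
    (hf : IsChainOn F (n + 1) f) : IsChainOn F n (boundary f) := by
  intro t ht
  obtain ⟨v, hv, hne⟩ := exists_insert_of_boundary_ne_zero ht
  obtain ⟨h₁, h₂⟩ := hf _ hne
  rw [Finset.card_insert_of_notMem hv] at h₂
  exact ⟨hF (Finset.subset_insert v t) h₁, by omega⟩

lemma boundary_boundary (f : Finset V → ℚ) : boundary (boundary f) = 0 := by
  ext t
  let g : V → V → ℚ := fun v u =>
    if u = v then 0 else incSign v t * (incSign u (insert v t) * f (insert u (insert v t)))
  have hg : boundary (boundary f) t = ∑ v ∈ tᶜ, ∑ u ∈ tᶜ, g v u := by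
    rw [boundary_apply]
    refine Finset.sum_congr rfl fun v hv => ?_
    rw [boundary_apply, Finset.mul_sum, ← Finset.sum_erase_add _ _ hv]
    simp only [g, if_true, add_zero]
    refine Finset.sum_congr (by ext; simp) fun u hu => ?_
    rw [if_neg (Finset.ne_of_mem_erase hu)]
  have hanti : ∀ v ∈ tᶜ, ∀ u ∈ tᶜ, g v u = -g u v := by
    intro v hv u hu
    simp only [Finset.mem_compl] at hv hu
    by_cases huv : u = v
    · simp [g, huv]
    · simp only [g, if_neg huv, if_neg (Ne.symm huv)]
      rw [← mul_assoc, incSign_mul_incSign_insert hu hv huv, Finset.insert_comm u v t]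
      ring
  have hself : boundary (boundary f) t = -boundary (boundary f) t := by
    conv_lhs => rw [hg, Finset.sum_comm]
    rw [hg, ← Finset.sum_neg_distrib]
    refine Finset.sum_congr rfl fun u hu => ?_
    rw [← Finset.sum_neg_distrib]
    exact Finset.sum_congr rfl fun v hv => hanti v hv u hu
  simpa using self_eq_neg.mp hself

lemma boundary_coneChain {e : V} {x : Finset V → ℚ} (hx : ∀ s, e ∈ s → x s = 0) :
    boundary (coneChain e x) = x - coneChain e (boundary x) := by
  ext t
  by_cases he : e ∈ t
  · obtain ⟨u, hu, rfl⟩ : ∃ u, e ∉ u ∧ insert e u = t :=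
      ⟨t.erase e, Finset.notMem_erase e t, Finset.insert_erase he⟩
    have heu : e ∈ uᶜ := by simpa using hu
    simp only [Pi.sub_apply, coneChain, if_pos he, hx _ he, Finset.erase_insert hu, zero_sub,
      boundary_apply]
    rw [← Finset.sum_erase_add _ _ heu, hx _ he, mul_zero, add_zero, Finset.mul_sum,
      ← Finset.sum_neg_distrib]
    refine Finset.sum_congr (by ext; simp) fun v hv => ?_
    have hv' : v ≠ e ∧ v ∉ u := by simpa using hv
    have hev : e ∉ insert v u := by simp [hv'.1.symm, hu]
    rw [if_pos (by simp), Finset.insert_comm, Finset.erase_insert hev, ← mul_assoc, ← mul_assoc,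
      ← neg_mul, incSign_insert hu v, incSign_insert hv'.2 e]
    congr 1
    rcases lt_or_gt_of_ne hv'.1 with h | h
    · simp [h, h.not_gt, mul_comm]
    · simp [h, h.not_gt, mul_comm]
  · have het : e ∈ tᶜ := by simpa using he
    simp only [Pi.sub_apply, coneChain, if_neg he, sub_zero, boundary_apply]
    rw [Finset.sum_eq_single_of_mem e het]
    · rw [if_pos (by simp), Finset.erase_insert he, ← mul_assoc, incSign_mul_self, one_mul]
    · intro v _ hv
      rw [if_neg (by simp [he, hv.symm]), mul_zero]

lemma boundary_parts_of_cycle {e : V} {z : Finset V → ℚ} (hz : boundary z = 0) :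
    boundary (deletionPart e z) = -linkPart e z ∧ boundary (linkPart e z) = 0 := by
  have hb : ∀ s, e ∈ s → linkPart e z s = 0 := fun s hs => by simp [linkPart, hs]
  have hoff : ∀ x : Finset V → ℚ, (∀ s, e ∈ s → x s = 0) → ∀ s, e ∈ s → boundary x s = 0 := by
    intro x hx s hs
    by_contra h
    obtain ⟨v, -, hv⟩ := exists_insert_of_boundary_ne_zero h
    exact hv (hx _ (Finset.mem_insert_of_mem hs))
  have ha := hoff (deletionPart e z) fun s hs => by simp [deletionPart, hs]
  have key : boundary (deletionPart e z) + (linkPart e z - coneChain e (boundary (linkPart e z)))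
      = 0 := by
    rw [← boundary_coneChain hb, ← map_add, deletionPart_add_coneChain_linkPart, hz]
  have key' := fun t => congrFun key t
  simp only [Pi.add_apply, Pi.sub_apply, Pi.zero_apply] at key'
  constructor
  · ext t
    by_cases he : e ∈ t
    · simp [ha t he, hb t he]
    · have := key' t
      simp only [coneChain, if_neg he, sub_zero] at this
      exact eq_neg_of_add_eq_zero_left this
  · ext t
    by_cases he : e ∈ t
    · simpa using hoff _ hb t he
    · have := key' (insert e t)
      have het : e ∈ insert e t := Finset.mem_insert_self e t
      rw [ha _ het, hb _ het] at this
      simp only [coneChain, if_pos het, Finset.erase_insert he] at this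
      simpa [incSign_ne_zero] using this

/-- Every `n`-cycle on `F` is a boundary, degrees being counted by cardinality of faces. -/
def AcyclicAt (F : Set (Finset V)) (n : ℕ) : Prop :=
  ∀ z, IsChainOn F n z → boundary z = 0 → ∃ w, IsChainOn F (n + 1) w ∧ boundary w = z

/-- If `F` contains `L` and a cone over `Y` as its members without and with `e`, then `F` is
acyclic at `n` provided `Y` is acyclic one degree lower and cycles on `L` are homologous to
cycles on `Y`. -/
lemma acyclicAt_of_deletion_link {F L Y : Set (Finset V)} {e : V} {n : ℕ}
    (hdel : ∀ T, e ∉ T → (T ∈ F ↔ T ∈ L)) (hlink : ∀ T, e ∉ T → (insert e T ∈ F ↔ T ∈ Y))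
    (hL : ∀ T ∈ L, e ∉ T) (hYL : Y ⊆ L) (hY : ∀ m, m + 1 = n → AcyclicAt Y m)
    (hsurj : ∀ c, IsChainOn L n c → boundary c = 0 →
      ∃ y l, IsChainOn Y n y ∧ boundary y = 0 ∧ IsChainOn L (n + 1) l ∧ c = y + boundary l) :
    AcyclicAt F n := by
  intro z hz hz0
  obtain ⟨hda, hdb⟩ := boundary_parts_of_cycle (e := e) hz0
  have hoff : ∀ {m x}, IsChainOn Y m x → ∀ s, e ∈ s → x s = 0 := by
    intro m x hx s hs
    by_contra h
    exact hL s (hYL (hx s h).1) hs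
  have hLF : L ⊆ F := fun T hT => (hdel T (hL T hT)).2 hT
  have hcone : ∀ s ∈ Y, insert e s ∈ F := fun s hs => (hlink s (hL s (hYL hs))).2 hs
  have ha : IsChainOn L n (deletionPart e z) := by
    intro s hs
    by_cases he : e ∈ s
    · simp [deletionPart, he] at hs
    · simp only [deletionPart, if_neg he] at hs
      exact ⟨(hdel s he).1 (hz s hs).1, (hz s hs).2⟩
  have hb : ∀ s, linkPart e z s ≠ 0 → s ∈ Y ∧ s.card + 1 = n := by
    intro s hs
    by_cases he : e ∈ s
    · simp [linkPart, he] at hs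
    · simp only [linkPart, if_neg he] at hs
      obtain ⟨h₁, h₂⟩ := hz _ (right_ne_zero_of_mul hs)
      exact ⟨(hlink s he).1 h₁, by rwa [Finset.card_insert_of_notMem he] at h₂⟩
  obtain ⟨b', hb', hbb'⟩ : ∃ b', IsChainOn Y n b' ∧ boundary b' = linkPart e z := by
    rcases n with _ | m
    · refine ⟨0, isChainOn_zero _ _, ?_⟩
      rw [map_zero]
      ext s
      by_contra h
      have := (hb s (Ne.symm h)).2
      omega
    · exact hY m rfl _ (fun s hs => ⟨(hb s hs).1, by have := (hb s hs).2; omega⟩) hdb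
  obtain ⟨y, l, hy, hy0, hl, hyl⟩ := hsurj (deletionPart e z + b') (ha.add (hb'.mono hYL))
    (by rw [map_add, hda, hbb', neg_add_cancel])
  refine ⟨coneChain e y + l - coneChain e b',
    ((hy.coneChain hcone).add (hl.mono hLF)).sub (hb'.coneChain hcone), ?_⟩
  have hcone0 : coneChain e (0 : Finset V → ℚ) = 0 := by ext t; simp [coneChain]
  rw [map_sub, map_add, boundary_coneChain (hoff hy), boundary_coneChain (hoff hb'), hy0, hbb',
    hcone0, sub_zero, ← hyl]
  conv_rhs => rw [← deletionPart_add_coneChain_linkPart e z]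
  abel

/-- A full simplex on a nonempty vertex set is acyclic. -/
lemma acyclicAt_powerset {S : Finset V} (hS : S.Nonempty) (n : ℕ) :
    AcyclicAt {T | T ⊆ S} n := by
  obtain ⟨e, he⟩ := hS
  intro z hz hz0
  obtain ⟨hda, -⟩ := boundary_parts_of_cycle (e := e) hz0
  have ha : IsChainOn {T | T ⊆ S} n (deletionPart e z) := by
    intro s hs
    refine hz s fun h => hs ?_
    simp [deletionPart, h]
  refine ⟨coneChain e (deletionPart e z), ha.coneChain fun s hs => Finset.insert_subset he hs, ?_⟩
  rw [boundary_coneChain fun s hs => by simp [deletionPart, hs], hda]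
  conv_rhs => rw [← deletionPart_add_coneChain_linkPart e z]
  ext t
  by_cases h : e ∈ t <;> simp [coneChain, h]

/-- If `L ∪ L'` is acyclic at `n`, every `n`-cycle on `L` is homologous to one on `L ∩ L'`. -/
lemma exists_cycle_inter_of_acyclicAt_union {L L' : Set (Finset V)} (hL : IsLowerSet L)
    (hL' : IsLowerSet L') {n : ℕ} (hU : AcyclicAt (L ∪ L') n) {c : Finset V → ℚ}
    (hc : IsChainOn L n c) (hc0 : boundary c = 0) :
    ∃ y l, IsChainOn (L ∩ L') n y ∧ boundary y = 0 ∧ IsChainOn L (n + 1) l ∧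
      c = y + boundary l := by
  classical
  obtain ⟨w, hw, hwc⟩ := hU c (hc.mono Set.subset_union_left) hc0
  let l : Finset V → ℚ := fun s => if s ∈ L then w s else 0
  let l' : Finset V → ℚ := fun s => if s ∈ L then 0 else w s
  have hl : IsChainOn L (n + 1) l := by
    intro s hs
    by_cases h : s ∈ L
    · exact ⟨h, (hw s (by simpa [l, h] using hs)).2⟩
    · simp [l, h] at hs
  have hl' : IsChainOn L' (n + 1) l' := by
    intro s hs
    by_cases h : s ∈ L
    · simp [l', h] at hs
    · obtain ⟨h₁, h₂⟩ := hw s (by simpa [l', h] using hs)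
      exact ⟨h₁.resolve_left h, h₂⟩
  have hll' : l + l' = w := by
    ext s
    by_cases h : s ∈ L <;> simp [l, l', h]
  have hy : c - boundary l = boundary l' := by
    rw [← hwc, ← hll', map_add, add_sub_cancel_left]
  refine ⟨c - boundary l, l, fun s hs => ?_, ?_, hl, (sub_add_cancel _ _).symm⟩
  · obtain ⟨h₁, h₂⟩ := (hc.sub (hl.boundary hL)) s hs
    exact ⟨⟨h₁, (hl'.boundary hL' s (by rwa [hy] at hs)).1⟩, h₂⟩
  · rw [map_sub, hc0, boundary_boundary, sub_zero]

end FunctionChains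

section Comparison

variable {V : Type*}

open Classical in
/-- Extension of a chain by zero to a coefficient function on all finite sets. -/
noncomputable def Chain.extend (X : SimplicialCpx V) (n : ℕ) :
    X.Chain n →ₗ[ℚ] (Finset V → ℚ) where
  toFun x s := if h : s ∈ X.faces ∧ s.card = n then x ⟨s, h⟩ else 0
  map_add' x y := by ext s; by_cases h : s ∈ X.faces ∧ s.card = n <;> simp [h]
  map_smul' c x := by ext s; by_cases h : s ∈ X.faces ∧ s.card = n <;> simp [h]

lemma Chain.extend_of_mem {X : SimplicialCpx V} {n : ℕ} (x : X.Chain n) {s : Finset V}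
    (h : s ∈ X.faces ∧ s.card = n) : Chain.extend X n x s = x ⟨s, h⟩ := by
  simp [Chain.extend, h]

lemma Chain.extend_of_notMem {X : SimplicialCpx V} {n : ℕ} (x : X.Chain n) {s : Finset V}
    (h : ¬ (s ∈ X.faces ∧ s.card = n)) : Chain.extend X n x s = 0 := by
  simp only [Chain.extend, LinearMap.coe_mk, AddHom.coe_mk, dif_neg h]

lemma Chain.extend_injective (X : SimplicialCpx V) (n : ℕ) :
    Function.Injective (Chain.extend X n) := by
  intro x y hxy
  ext s
  have := congrFun hxy s.1
  rwa [Chain.extend_of_mem x s.2, Chain.extend_of_mem y s.2] at this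

lemma Chain.isChainOn_extend {X : SimplicialCpx V} {n : ℕ} (x : X.Chain n) :
    IsChainOn X.faces n (Chain.extend X n x) := by
  intro s hs
  by_contra h
  exact hs (Chain.extend_of_notMem x h)

lemma Chain.exists_extend_eq [Finite V] {X : SimplicialCpx V} {n : ℕ} {f : Finset V → ℚ}
    (hf : IsChainOn X.faces n f) : ∃ x, Chain.extend X n x = f := by
  classical
  refine ⟨Finsupp.equivFunOnFinite.symm fun s => f s.1, ?_⟩
  ext s
  by_cases h : s ∈ X.faces ∧ s.card = n
  · rw [Chain.extend_of_mem _ h]; rfl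
  · rw [Chain.extend_of_notMem _ h]
    by_contra h'
    exact h (hf s (Ne.symm h'))

variable [LinearOrder V]

lemma Chain.extend_single {X : SimplicialCpx V} {n : ℕ}
    (s : {s : Finset V // s ∈ X.faces ∧ s.card = n}) (c : ℚ) :
    Chain.extend X n (Finsupp.single s c) = Pi.single s.1 c := by
  ext t
  by_cases h : t ∈ X.faces ∧ t.card = n
  · rw [Chain.extend_of_mem _ h, Finsupp.single_apply, Pi.single_apply]
    exact if_congr (by rw [Subtype.ext_iff]; exact eq_comm) rfl rfl
  · rw [Chain.extend_of_notMem _ h, Pi.single_apply, if_neg]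
    rintro rfl
    exact h s.2

variable [Fintype V]

lemma boundary_single (s : Finset V) :
    boundary (Pi.single s (1 : ℚ)) = ∑ v ∈ s, incSign v s • Pi.single (s.erase v) (1 : ℚ) := by
  ext t
  rw [boundary_apply, Finset.sum_apply]
  simp only [Pi.smul_apply, Pi.single_apply, smul_eq_mul, mul_ite, mul_one, mul_zero]
  rw [← Finset.sum_filter, ← Finset.sum_filter]
  have hset : tᶜ.filter (fun v => insert v t = s) = s.filter (fun v => t = s.erase v) := by
    ext v
    simp only [Finset.mem_filter, Finset.mem_compl]
    constructor
    · rintro ⟨hv, rfl⟩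
      exact ⟨Finset.mem_insert_self v t, (Finset.erase_insert hv).symm⟩
    · rintro ⟨hv, rfl⟩
      exact ⟨Finset.notMem_erase v s, Finset.insert_erase hv⟩
  rw [hset]
  refine Finset.sum_congr rfl fun v hv => ?_
  obtain ⟨hv, ht⟩ := Finset.mem_filter.mp hv
  rw [ht, ← incSign_insert_self v (s.erase v), Finset.insert_erase hv]

lemma Chain.extend_bdry (X : SimplicialCpx V) (n : ℕ) (x : X.Chain (n + 1)) :
    Chain.extend X n (X.bdry n x) = boundary (Chain.extend X (n + 1) x) := by
  have : Chain.extend X n ∘ₗ X.bdry n = boundary ∘ₗ Chain.extend X (n + 1) := by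
    refine Finsupp.lhom_ext' fun s => LinearMap.ext_ring ?_
    simp only [LinearMap.comp_apply, Finsupp.lsingle_apply, Chain.extend_single, boundary_single]
    rw [bdry, Finsupp.lsum_single, LinearMap.toSpanSingleton_apply, one_smul, map_sum,
      ← Finset.sum_attach s.1]
    refine Finset.sum_congr rfl fun v _ => ?_
    rw [map_smul, Chain.extend_single, incSign]
  exact LinearMap.congr_fun this x

lemma subsingleton_redH_of_acyclicAt {X : SimplicialCpx V} {n : ℕ}
    (h : AcyclicAt X.faces n) : Subsingleton (X.redH n) := by
  unfold redH
  rw [Submodule.Quotient.subsingleton_iff, eq_top_iff]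
  rintro ⟨z, hz⟩ -
  have hz0 : boundary (Chain.extend X n z) = 0 := by
    cases n with
    | zero =>
      ext t
      by_contra hne
      obtain ⟨v, -, hv⟩ := exists_insert_of_boundary_ne_zero hne
      have := (Chain.isChainOn_extend z _ hv).2
      simp at this
    | succ m =>
      rw [← Chain.extend_bdry, LinearMap.mem_ker.mp hz, map_zero]
  obtain ⟨w, hw, hwz⟩ := h _ (Chain.isChainOn_extend z) hz0
  obtain ⟨w, rfl⟩ := Chain.exists_extend_eq hw
  rw [← Chain.extend_bdry] at hwz
  exact ⟨w, Chain.extend_injective X n hwz⟩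

end Comparison

end SimplicialCpx

namespace OrientedMatroid

open SimplicialCpx

variable {V : Type*} [LinearOrder V] (M : OrientedMatroid V)

/-- The subsets of `S` whose complement in `S` contains, up to elements of `P` with positive sign
and of `N` with negative sign, a positive circuit. For `P = N = A` this is the Alexander dual of
the support complex of the minor of `M` on `S` obtained by contracting `A`. -/
def dualFaces (S P N : Finset V) : Set (Finset V) :=
  {T | T ⊆ S ∧ ∃ C ∈ M.Circuits, C.pos ⊆ P ∪ (S \ T) ∧ C.neg ⊆ N}

lemma isLowerSet_dualFaces (S P N : Finset V) : IsLowerSet (M.dualFaces S P N) := by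
  rintro s t hts ⟨hs, C, hC, hpos, hneg⟩
  exact ⟨hts.trans hs, C, hC, hpos.trans
    (Finset.union_subset_union_right (Finset.sdiff_subset_sdiff subset_rfl hts)), hneg⟩

variable {M}

lemma dualFaces_mono {S P N P' N' : Finset V} (hP : P ⊆ P') (hN : N ⊆ N') :
    M.dualFaces S P N ⊆ M.dualFaces S P' N' := by
  rintro T ⟨hT, C, hC, hpos, hneg⟩
  exact ⟨hT, C, hC, hpos.trans (Finset.union_subset_union_left hP), hneg.trans hN⟩

lemma dualFaces_union {S A : Finset V} {e : V} :
    M.dualFaces S (insert e A) A ∪ M.dualFaces S A (insert e A) =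
      M.dualFaces S (insert e A) (insert e A) := by
  refine Set.Subset.antisymm (Set.union_subset
    (dualFaces_mono subset_rfl (Finset.subset_insert e A))
    (dualFaces_mono (Finset.subset_insert e A) subset_rfl)) ?_
  rintro T ⟨hT, C, hC, hpos, hneg⟩
  by_cases he : e ∈ C.pos
  · refine Or.inl ⟨hT, C, hC, hpos, fun x hx => ?_⟩
    refine (Finset.mem_insert.mp (hneg hx)).resolve_left ?_
    rintro rfl
    exact Finset.disjoint_left.mp C.disj he hx
  · refine Or.inr ⟨hT, C, hC, fun x hx => ?_, hneg⟩
    have hxe : x ≠ e := by rintro rfl; exact he hx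
    simpa [hxe] using hpos hx

lemma dualFaces_inter {S A : Finset V} {e : V} (hA : M.Indep (insert e A)) :
    M.dualFaces S (insert e A) A ∩ M.dualFaces S A (insert e A) = M.dualFaces S A A := by
  refine Set.Subset.antisymm ?_ (Set.subset_inter
    (dualFaces_mono (Finset.subset_insert e A) subset_rfl)
    (dualFaces_mono subset_rfl (Finset.subset_insert e A)))
  rintro T ⟨⟨hT, C, hC, hCpos, hCneg⟩, -, D, hD, hDpos, hDneg⟩
  by_cases heC : e ∈ C.pos
  · by_cases heD : e ∈ D.neg
    · have hne : C ≠ D.negate := by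
        rintro rfl
        exact hA _ hC (Finset.union_subset hDneg (hCneg.trans (Finset.subset_insert e A)))
      obtain ⟨Z, hZ, hZpos, hZneg⟩ :=
        M.elimination C hC D hD hne e (Finset.mem_inter.mpr ⟨heC, heD⟩)
      refine ⟨hT, Z, hZ, fun x hx => ?_, fun x hx => ?_⟩
      · obtain ⟨hxe, hx⟩ := Finset.mem_erase.mp (hZpos hx)
        rcases Finset.mem_union.mp hx with hx | hx
        · simpa [hxe] using hCpos hx
        · exact hDpos hx
      · obtain ⟨hxe, hx⟩ := Finset.mem_erase.mp (hZneg hx)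
        rcases Finset.mem_union.mp hx with hx | hx
        · exact hCneg hx
        · exact (Finset.mem_insert.mp (hDneg hx)).resolve_left hxe
    · refine ⟨hT, D, hD, hDpos, fun x hx => (Finset.mem_insert.mp (hDneg hx)).resolve_left ?_⟩
      rintro rfl
      exact heD hx
  · refine ⟨hT, C, hC, fun x hx => ?_, hCneg⟩
    have hxe : x ≠ e := by rintro rfl; exact heC hx
    simpa [hxe] using hCpos hx

lemma mem_dualFaces_insert_of_notMem {S P N T : Finset V} {e : V} (heT : e ∉ T) :
    T ∈ M.dualFaces (insert e S) P N ↔ T ∈ M.dualFaces S (insert e P) N := by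
  have h : P ∪ (insert e S \ T) = insert e P ∪ (S \ T) := by
    ext x
    by_cases hx : x = e
    · simp [hx, heT]
    · simp [hx]
  simp only [dualFaces, Set.mem_ofPred_eq, h, Finset.subset_insert_iff_of_notMem heT]

lemma insert_mem_dualFaces_insert {S P N T : Finset V} {e : V} (heS : e ∉ S) (heT : e ∉ T) :
    insert e T ∈ M.dualFaces (insert e S) P N ↔ T ∈ M.dualFaces S P N := by
  have h : insert e S \ insert e T = S \ T := by
    ext x
    by_cases hx : x = e
    · simp [hx, heS]
    · simp [hx]
  simp only [dualFaces, Set.mem_ofPred_eq, h, Finset.insert_subset_insert_iff heT]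

/-- If `e` is a loop of the contraction by `A`, the faces avoiding `e` form a full simplex. -/
lemma dualFaces_eq_powerset {S A : Finset V} {e : V} (hA : M.Indep A)
    (he : ¬ M.Indep (insert e A)) : M.dualFaces S (insert e A) A = {T | T ⊆ S} := by
  refine Set.Subset.antisymm (fun T hT => hT.1) fun T hT => ⟨hT, ?_⟩
  have main : ∀ C ∈ M.Circuits, C.support ⊆ insert e A → e ∈ C.pos →
      C.pos ⊆ insert e A ∪ (S \ T) ∧ C.neg ⊆ A := by
    intro C _ hsub heC
    refine ⟨(Finset.subset_union_left.trans hsub).trans Finset.subset_union_left, fun x hx => ?_⟩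
    refine (Finset.mem_insert.mp (hsub (Finset.mem_union_right _ hx))).resolve_left ?_
    rintro rfl
    exact Finset.disjoint_left.mp C.disj heC hx
  simp only [Indep, not_forall, not_not] at he
  obtain ⟨C, hC, hsub⟩ := he
  have heC : e ∈ C.support := by
    by_contra h
    exact hA C hC ((Finset.subset_insert_iff_of_notMem h).mp hsub)
  rcases Finset.mem_union.mp heC with h | h
  · exact ⟨C, hC, main C hC hsub h⟩
  · refine ⟨C.negate, M.negate_mem C hC, main _ (M.negate_mem C hC) ?_ h⟩
    rwa [SignedSet.support, Finset.union_comm]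

lemma acyclicAt_dualFaces [Fintype V] (S : Finset V) : ∀ (A : Finset V) (d n : ℕ), M.Indep A →
    (∀ I ⊆ S, M.Indep (A ∪ I) → I.card ≤ d) → n + d + 2 ≤ S.card →
    AcyclicAt (M.dualFaces S A A) n := by
  induction S using Finset.induction_on with
  | empty => intro A d n _ _ h; simp at h
  | insert e S he ih =>
    intro A d n hA hd hn
    rw [Finset.card_insert_of_notMem he] at hn
    have hdS : ∀ I ⊆ S, M.Indep (A ∪ I) → I.card ≤ d :=
      fun I hI => hd I (hI.trans (Finset.subset_insert e S))
    refine acyclicAt_of_deletion_link (fun T => mem_dualFaces_insert_of_notMem)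
      (fun T => insert_mem_dualFaces_insert he) (fun T hT h => he (hT.1 h))
      (dualFaces_mono (Finset.subset_insert e A) subset_rfl)
      (fun m hm => ih A d m hA hdS (by omega)) fun c hc hc0 => ?_
    by_cases hAe : M.Indep (insert e A)
    · have hd₁ : ∀ I ⊆ S, M.Indep (insert e A ∪ I) → I.card + 1 ≤ d := by
        intro I hI hInd
        rw [← Finset.card_insert_of_notMem fun h => he (hI h)]
        refine hd _ (Finset.insert_subset_insert e hI) ?_
        rwa [Finset.union_insert, ← Finset.insert_union]
      have hd₀ := hd₁ ∅ (Finset.empty_subset S) (by simpa using hAe)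
      rw [← dualFaces_inter hAe]
      refine exists_cycle_inter_of_acyclicAt_union (M.isLowerSet_dualFaces _ _ _)
        (M.isLowerSet_dualFaces _ _ _) ?_ hc hc0
      rw [dualFaces_union]
      refine ih (insert e A) (d - 1) n hAe (fun I hI hInd => ?_) ?_
      · have := hd₁ I hI hInd
        omega
      · simp only [Finset.card_empty] at hd₀
        omega
    · rw [dualFaces_eq_powerset hA hAe] at hc ⊢
      obtain ⟨l, hl, hlc⟩ := acyclicAt_powerset (Finset.card_pos.mp (by omega)) n c hc hc0
      exact ⟨0, l, isChainOn_zero _ _, map_zero _, hl, by rw [hlc, zero_add]⟩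

lemma card_le_rank [Fintype V] {I : Finset V} (hI : M.Indep I) : I.card ≤ M.rank :=
  le_csSup ⟨Fintype.card V, by rintro _ ⟨S, -, rfl⟩; exact S.card_le_univ⟩ ⟨I, hI, rfl⟩

lemma faces_dual_suppComplex [Fintype V] (h : (Finset.univ : Finset V) ∉ M.suppComplex.faces) :
    (M.suppComplex.dual h).faces = M.dualFaces Finset.univ ∅ ∅ := by
  ext T
  simp only [SimplicialCpx.dual, suppComplex, PosCircuit, dualFaces, Set.mem_ofPred_eq, not_forall,
    not_not, Finset.subset_univ, true_and, Finset.empty_union, Finset.subset_empty]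
  constructor
  · rintro ⟨_, hsub, C, hC, hneg, rfl⟩
    exact ⟨C, hC, hsub, hneg⟩
  · rintro ⟨C, hC, hsub, hneg⟩
    exact ⟨C.pos, hsub, C, hC, hneg, rfl⟩

end OrientedMatroid

/-- Let `M` be a loopless oriented matroid of rank `r` with at least one positive
circuit and support complex `X` on finite ground set `V` (so that `V ∉ X`, with
witness `h`).  Then the Alexander dual satisfies `H̃ᵢ(X^⋆;ℚ) = 0` for all
`i ≤ |V| - r - 3` (in our indexing `redH n = H̃_{n-1}` vanishes for
`n + r + 2 ≤ |V|`), i.e. `η(X^⋆) ≥ |V| - r - 1`. -/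
theorem dual_suppComplex_homology {V : Type*} [LinearOrder V] [Fintype V]
    (M : OrientedMatroid V) (hM : M.Loopless) (r : ℕ) (hr : M.rank = r)
    (hpc : ∃ T : Finset V, M.PosCircuit T)
    (h : (Finset.univ : Finset V) ∉ M.suppComplex.faces) :
    (∀ n : ℕ, n + r + 2 ≤ Fintype.card V →
      Subsingleton ((M.suppComplex.dual h).redH n)) ∧
    ((Fintype.card V - r - 1 : ℕ) : ℕ∞) ≤ (M.suppComplex.dual h).eta := by
  have hred : ∀ n : ℕ, n + r + 2 ≤ Fintype.card V →
      Subsingleton ((M.suppComplex.dual h).redH n) := by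
    intro n hn
    refine SimplicialCpx.subsingleton_redH_of_acyclicAt ?_
    rw [OrientedMatroid.faces_dual_suppComplex]
    refine OrientedMatroid.acyclicAt_dualFaces Finset.univ ∅ r n (fun C hC hsub => ?_)
      (fun I _ hI => ?_) hn
    · exact (M.support_nonempty C hC).ne_empty (Finset.subset_empty.mp hsub)
    · rw [Finset.empty_union] at hI
      exact hr ▸ OrientedMatroid.card_le_rank hI
  refine ⟨hred, le_sInf ?_⟩
  rintro _ ⟨m, rfl, hm⟩
  by_contra hlt
  rw [not_le, Nat.cast_lt] at hlt
  exact not_subsingleton _ (hred m (by omega))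
end
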